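/- Let λ = sup_{t∈(0,1)} sup_{α≠0} ‖Σ^{−1/2}XᵀD(B̂+tα)Xα‖²/‖Σ^{1/2}α‖² and assume λ < 1. Set L = p(1+λ), fix d > 2L/(1−λ) and r ∈ (0,1), let ε = 2^{−p/2} e^{−d}, and let ρ̂ = max{ (1−ε)^r , ((1+2L+λd)/(1+d))^{1−r} (1+2(λd+L))^r }. For β ∈ ℝ^p let φ̄(β) ∈ ℝⁿ have i-th entry X_iᵀβ + φ(X_iᵀβ)/Φ(X_iᵀβ)·1{Y_i=1} − φ(X_iᵀβ)/(1−Φ(X_iᵀβ))·1{Y_i=0}, and define H(β) = 2 + L/(1−λ) + tr(X Σ⁻¹ Xᵀ) + ‖ Σ^{1/2}( Σ⁻¹(Xᵀφ̄(β)+Qv) − B̂ ) ‖². Then for every m ≥ 1 and every β ∈ ℝ^p, ∫_{ℝ^p} | k_AC^{(m)}(β,β') − π_{B|Y,X}(β') | dβ' ≤ H(β) · ρ̂^{m−1}. -/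

import Mathlib

open MeasureTheory Matrix Filter

noncomputable section

/-- standard normal pdf -/
def nphi (x : ℝ) : ℝ := (Real.sqrt (2 * Real.pi))⁻¹ * Real.exp (-(x ^ 2) / 2)

/-- standard normal cdf -/
def nPhi (x : ℝ) : ℝ := ∫ t in Set.Iic x, nphi t

/-- density of TN(θ,1;1) (if b = true) resp. TN(θ,1;0) (if b = false) at z -/
def tn (θ : ℝ) (b : Bool) (z : ℝ) : ℝ :=
  if b then (if 0 < z then nphi (z - θ) / nPhi θ else 0)
  else (if z < 0 then nphi (z - θ) / (1 - nPhi θ) else 0)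

/-- p-variate Gaussian density with mean μ and covariance matrix Λ -/
def mvn {p : ℕ} (μ : Fin p → ℝ) (Λ : Matrix (Fin p) (Fin p) ℝ) (x : Fin p → ℝ) : ℝ :=
  Real.sqrt (((2 * Real.pi) ^ p * Λ.det)⁻¹) *
    Real.exp (-(dotProduct (x - μ) (Λ⁻¹.mulVec (x - μ))) / 2)

/-- squared Euclidean norm -/
def normSq {m : ℕ} (x : Fin m → ℝ) : ℝ := ∑ i, x i ^ 2

/-- Albert and Chib's Markov transition density, with Σ = XᵀX + Q -/
def kAC {n p : ℕ} (X : Matrix (Fin n) (Fin p) ℝ) (Y : Fin n → Bool)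
    (v : Fin p → ℝ) (Q : Matrix (Fin p) (Fin p) ℝ) (β β' : Fin p → ℝ) : ℝ :=
  ∫ z : Fin n → ℝ,
    mvn ((Xᵀ * X + Q)⁻¹.mulVec (Xᵀ.mulVec z + Q.mulVec v)) (Xᵀ * X + Q)⁻¹ β' *
      ∏ i, tn (dotProduct (X i) β) (Y i) (z i)

/-- the defining property of the posterior mode B̂ -/
def IsPosteriorMode {n p : ℕ} (X : Matrix (Fin n) (Fin p) ℝ) (Y : Fin n → Bool)
    (v : Fin p → ℝ) (Q : Matrix (Fin p) (Fin p) ℝ) (Bhat : Fin p → ℝ) : Prop :=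
  (∑ i, (if Y i then nphi (dotProduct (X i) Bhat) / nPhi (dotProduct (X i) Bhat)
          else -(nphi (dotProduct (X i) Bhat) / (1 - nPhi (dotProduct (X i) Bhat)))) • X i)
    - Q.mulVec (Bhat - v) = 0

/-- g(θ) = θφ(θ)/Φ(θ) + (φ(θ)/Φ(θ))² -/
def gfun (θ : ℝ) : ℝ := θ * nphi θ / nPhi θ + (nphi θ / nPhi θ) ^ 2

/-- the diagonal matrix D(β) -/
def Dmat {n p : ℕ} (X : Matrix (Fin n) (Fin p) ℝ) (Y : Fin n → Bool) (β : Fin p → ℝ) :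
    Matrix (Fin n) (Fin n) ℝ :=
  Matrix.diagonal fun i =>
    1 - (if Y i then gfun (dotProduct (X i) β) else gfun (-(dotProduct (X i) β)))

/-- `kIter k m` is the (m+1)-step transition density associated with a transition
density `k`. -/
def kIter {A : Type*} [MeasureSpace A] (k : A → A → ℝ) : ℕ → A → A → ℝ
  | 0 => k
  | m + 1 => fun x y => ∫ z, kIter k m x z * k z y

/-- unnormalized posterior density -/
def postUnnorm {n p : ℕ} (X : Matrix (Fin n) (Fin p) ℝ) (Y : Fin n → Bool)
    (v : Fin p → ℝ) (Q : Matrix (Fin p) (Fin p) ℝ) (β : Fin p → ℝ) : ℝ :=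
  (∏ i, if Y i then nPhi (dotProduct (X i) β) else 1 - nPhi (dotProduct (X i) β)) *
    Real.exp (-(dotProduct (β - v) (Q.mulVec (β - v))) / 2)

/-- the (normalized) posterior density -/
def postDen {n p : ℕ} (X : Matrix (Fin n) (Fin p) ℝ) (Y : Fin n → Bool)
    (v : Fin p → ℝ) (Q : Matrix (Fin p) (Fin p) ℝ) (β : Fin p → ℝ) : ℝ :=
  postUnnorm X Y v Q β / ∫ β', postUnnorm X Y v Q β'

/-- E(Z | B = β, Y, X) ∈ ℝⁿ -/
def phibar {n p : ℕ} (X : Matrix (Fin n) (Fin p) ℝ) (Y : Fin n → Bool)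
    (β : Fin p → ℝ) (i : Fin n) : ℝ :=
  dotProduct (X i) β +
    (if Y i then nphi (dotProduct (X i) β) / nPhi (dotProduct (X i) β)
     else -(nphi (dotProduct (X i) β) / (1 - nPhi (dotProduct (X i) β))))

lemma nphi_pos (x : ℝ) : 0 < nphi x := by unfold nphi; positivity

lemma nphi_neg (x : ℝ) : nphi (-x) = nphi x := by unfold nphi; simp

lemma continuous_nphi : Continuous nphi := by unfold nphi; fun_prop

lemma nphi_eq_gaussian (x : ℝ) : nphi x = ProbabilityTheory.gaussianPDFReal 0 1 x := by
  simp [nphi, ProbabilityTheory.gaussianPDFReal]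

lemma integrable_nphi : Integrable nphi := by
  have := ProbabilityTheory.integrable_gaussianPDFReal 0 1
  rwa [show nphi = ProbabilityTheory.gaussianPDFReal 0 1 from funext nphi_eq_gaussian]

lemma integral_nphi : ∫ x, nphi x = 1 := by
  simp_rw [nphi_eq_gaussian]
  exact ProbabilityTheory.integral_gaussianPDFReal_eq_one 0 (by simp)

lemma integrable_id_nphi : Integrable (fun x => x * nphi x) := by
  have := (integrable_mul_exp_neg_mul_sq (b := 1/2) (by norm_num)).const_mul
    ((Real.sqrt (2 * Real.pi))⁻¹)
  refine this.congr (Eventually.of_forall fun x => ?_)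
  simp only [nphi]
  rw [show -(x^2)/2 = -(1/2) * x^2 by ring]; ring

lemma integrable_sq_nphi : Integrable (fun x => x ^ 2 * nphi x) := by
  have := (integrable_rpow_mul_exp_neg_mul_sq (b := 1/2) (by norm_num) (s := 2)
    (by norm_num)).const_mul ((Real.sqrt (2 * Real.pi))⁻¹)
  refine this.congr (Eventually.of_forall fun x => ?_)
  simp only [nphi]
  rw [show -(x^2)/2 = -(1/2) * x^2 by ring]
  norm_num
  ring

lemma hasDerivAt_nphi (x : ℝ) : HasDerivAt nphi (-(x * nphi x)) x := by
  unfold nphi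
  have h : HasDerivAt (fun x : ℝ => -(x^2)/2) (-x) x := by
    refine (((hasDerivAt_pow 2 x).fun_neg).div_const 2).congr_deriv ?_
    norm_num
    ring
  refine (h.exp.const_mul ((Real.sqrt (2 * Real.pi))⁻¹)).congr_deriv ?_
  ring

lemma hasDerivAt_nPhi (x : ℝ) : HasDerivAt nPhi (nphi x) x := by
  have h1 : nPhi = fun y => (∫ t in Set.Iic 0, nphi t) + ∫ t in (0:ℝ)..y, nphi t := by
    funext y
    have := intervalIntegral.integral_Iic_sub_Iic (μ := volume) (f := nphi) (a := 0) (b := y)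
      integrable_nphi.integrableOn integrable_nphi.integrableOn
    unfold nPhi
    linarith
  rw [h1]
  exact (intervalIntegral.integral_hasDerivAt_right
    (continuous_nphi.intervalIntegrable _ _)
    continuous_nphi.stronglyMeasurable.stronglyMeasurableAtFilter
    continuous_nphi.continuousAt).const_add _

lemma continuous_nPhi : Continuous nPhi :=
  continuous_iff_continuousAt.2 fun x => (hasDerivAt_nPhi x).continuousAt

lemma nPhi_pos (x : ℝ) : 0 < nPhi x := by
  unfold nPhi
  rw [setIntegral_pos_iff_support_of_nonneg_ae (Eventually.of_forall fun x => (nphi_pos x).le)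
    integrable_nphi.integrableOn]
  have : Function.support nphi = Set.univ := by
    ext x; simp [(nphi_pos x).ne']
  simp [this]

lemma nPhi_neg (x : ℝ) : nPhi (-x) = 1 - nPhi x := by
  have h1 : nPhi (-x) = ∫ t in Set.Ioi x, nphi t := by
    unfold nPhi
    have := integral_comp_neg_Iic (-x) nphi
    simp only [nphi_neg, neg_neg] at this
    exact this
  have h2 := integral_add_compl (measurableSet_Iic (a := x)) integrable_nphi
  rw [Set.compl_Iic, integral_nphi] at h2
  rw [h1]; unfold nPhi; linarith

lemma nPhi_lt_one (x : ℝ) : nPhi x < 1 := by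
  have := nPhi_pos (-x); rw [nPhi_neg] at this; linarith

lemma setIntegral_nphi_shift (θ : ℝ) : ∫ z in Set.Ioi (0:ℝ), nphi (z - θ) = nPhi θ := by
  unfold nPhi
  rw [← integral_indicator measurableSet_Iic, ← integral_Ici_eq_integral_Ioi,
    ← integral_indicator measurableSet_Ici,
    ← integral_sub_left_eq_self (fun t => (Set.Iic θ).indicator nphi t) volume θ]
  congr 1; funext z
  by_cases hz : 0 ≤ z
  · simp [Set.indicator, hz]; rw [← nphi_neg]; congr 1; ring
  · simp [Set.indicator, hz]

lemma setIntegral_id_nphi_shift (θ : ℝ) :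
    ∫ z in Set.Ioi (0:ℝ), (z - θ) * nphi (z - θ) = nphi θ := by
  have hd : ∀ z ∈ Set.Ici (0:ℝ), HasDerivAt (fun z => - nphi (z - θ)) ((z - θ) * nphi (z - θ)) z := by
    intro z _
    exact (((hasDerivAt_nphi (z - θ)).comp_sub_const z θ).fun_neg).congr_deriv (by ring)
  have hi : IntegrableOn (fun z => (z - θ) * nphi (z - θ)) (Set.Ioi 0) :=
    (integrable_id_nphi.comp_sub_right θ).integrableOn
  have hi2 : IntegrableOn (fun z => - nphi (z - θ)) (Set.Ioi 0) :=
    (integrable_nphi.comp_sub_right θ).neg.integrableOn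
  have := integral_Ioi_of_hasDerivAt_of_tendsto' hd hi
    (tendsto_zero_of_hasDerivAt_of_integrableOn_Ioi
      (fun x hx => hd x (Set.mem_Ici_of_Ioi hx)) hi hi2)
  rw [this]; simp [nphi_neg]

lemma setIntegral_sq_nphi_shift (θ : ℝ) :
    ∫ z in Set.Ioi (0:ℝ), (z - θ) ^ 2 * nphi (z - θ) = nPhi θ - θ * nphi θ := by
  have hd : ∀ z ∈ Set.Ici (0:ℝ), HasDerivAt (fun z => - ((z - θ) * nphi (z - θ)))
      ((z - θ)^2 * nphi (z - θ) - nphi (z - θ)) z := by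
    intro z _
    have h0 : HasDerivAt (fun z => z - θ) 1 z := (hasDerivAt_id z).sub_const θ
    exact ((h0.fun_mul ((hasDerivAt_nphi (z - θ)).comp_sub_const z θ)).fun_neg).congr_deriv (by ring)
  have hiA : IntegrableOn (fun z => (z - θ)^2 * nphi (z - θ)) (Set.Ioi 0) :=
    (integrable_sq_nphi.comp_sub_right θ).integrableOn
  have hiB : IntegrableOn (fun z => nphi (z - θ)) (Set.Ioi 0) :=
    (integrable_nphi.comp_sub_right θ).integrableOn
  have hi2 : IntegrableOn (fun z => - ((z - θ) * nphi (z - θ))) (Set.Ioi 0) :=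
    (integrable_id_nphi.comp_sub_right θ).neg.integrableOn
  have := integral_Ioi_of_hasDerivAt_of_tendsto' hd (hiA.sub hiB)
    (tendsto_zero_of_hasDerivAt_of_integrableOn_Ioi
      (fun x hx => hd x (Set.mem_Ici_of_Ioi hx)) (hiA.sub hiB) hi2)
  rw [integral_sub hiA hiB, setIntegral_nphi_shift] at this
  simp [nphi_neg] at this
  linarith

/-- mean of the truncated normal -/
def tmean (θ : ℝ) (b : Bool) : ℝ :=
  θ + if b then nphi θ / nPhi θ else -(nphi θ / (1 - nPhi θ))

/-- variance of the truncated normal -/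
def tvar (θ : ℝ) (b : Bool) : ℝ := 1 - if b then gfun θ else gfun (-θ)

lemma tmean_false (θ : ℝ) : tmean θ false = - tmean (-θ) true := by
  simp [tmean, nphi_neg, nPhi_neg]; ring

lemma tvar_false (θ : ℝ) : tvar θ false = tvar (-θ) true := by
  simp [tvar]

lemma tn_false (θ z : ℝ) : tn θ false z = tn (-θ) true (-z) := by
  simp only [tn, nPhi_neg]
  rw [show -z - -θ = -(z - θ) by ring, nphi_neg]; simp

lemma tn_nonneg (θ : ℝ) (b : Bool) (z : ℝ) : 0 ≤ tn θ b z := by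
  have := nPhi_pos θ
  have := nPhi_lt_one θ
  have h3 := nphi_pos (z - θ)
  unfold tn
  split_ifs <;> first | exact le_rfl | (apply div_nonneg h3.le; linarith)

lemma tn_true_eq (θ : ℝ) (f : ℝ → ℝ) :
    (fun z => f z * tn θ true z) = (Set.Ioi (0:ℝ)).indicator
      (fun z => (nPhi θ)⁻¹ * (f z * nphi (z - θ))) := by
  funext z
  by_cases hz : 0 < z
  · simp [tn, hz, Set.indicator]; ring
  · simp [tn, hz, Set.indicator]

lemma tn_true_moments (θ : ℝ) (a b c : ℝ) :
    Integrable (fun z => (a + b * (z - θ) + c * (z - θ)^2) * tn θ true z) ∧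
    ∫ z, (a + b * (z - θ) + c * (z - θ)^2) * tn θ true z
      = a + b * (nphi θ / nPhi θ) + c * (1 - θ * (nphi θ / nPhi θ)) := by
  have hiA : IntegrableOn (fun z => (z - θ)^2 * nphi (z - θ)) (Set.Ioi 0) :=
    (integrable_sq_nphi.comp_sub_right θ).integrableOn
  have hiB : IntegrableOn (fun z => nphi (z - θ)) (Set.Ioi 0) :=
    (integrable_nphi.comp_sub_right θ).integrableOn
  have hiC : IntegrableOn (fun z => (z - θ) * nphi (z - θ)) (Set.Ioi 0) :=
    (integrable_id_nphi.comp_sub_right θ).integrableOn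
  have e : (fun z => (nPhi θ)⁻¹ * ((a + b * (z - θ) + c * (z - θ)^2) * nphi (z - θ)))
     = fun z => (nPhi θ)⁻¹ * (a * nphi (z - θ) + b * ((z - θ) * nphi (z - θ))
        + c * ((z - θ)^2 * nphi (z - θ))) := by funext z; ring
  have hP := (nPhi_pos θ).ne'
  rw [tn_true_eq θ (fun z => a + b * (z - θ) + c * (z - θ)^2), integral_indicator measurableSet_Ioi,
    integrable_indicator_iff measurableSet_Ioi, e]
  have hAB := (hiB.const_mul a).add (hiC.const_mul b)
  refine ⟨((hAB.add (hiA.const_mul c)).const_mul _), ?_⟩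
  rw [integral_const_mul]
  rw [show (∫ z in Set.Ioi (0:ℝ), (a * nphi (z - θ) + b * ((z - θ) * nphi (z - θ))
        + c * ((z - θ)^2 * nphi (z - θ)))) = _ from integral_add hAB (hiA.const_mul c)]
  rw [show (∫ z in Set.Ioi (0:ℝ), (a * nphi (z - θ) + b * ((z - θ) * nphi (z - θ)))) = _
    from integral_add (hiB.const_mul a) (hiC.const_mul b)]
  rw [integral_const_mul, integral_const_mul, integral_const_mul, setIntegral_nphi_shift,
    setIntegral_id_nphi_shift, setIntegral_sq_nphi_shift]
  field_simp

lemma tn_moments (θ : ℝ) (b : Bool) :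
    Integrable (fun z => (z - tmean θ b) * tn θ b z) ∧
    Integrable (fun z => (z - tmean θ b)^2 * tn θ b z) ∧
    Integrable (fun z => tn θ b z) ∧
    ∫ z, tn θ b z = 1 ∧ ∫ z, (z - tmean θ b) * tn θ b z = 0 ∧
    ∫ z, (z - tmean θ b)^2 * tn θ b z = tvar θ b := by
  have key : ∀ θ, Integrable (fun z => (z - tmean θ true) * tn θ true z) ∧
    Integrable (fun z => (z - tmean θ true)^2 * tn θ true z) ∧
    Integrable (fun z => tn θ true z) ∧
    ∫ z, tn θ true z = 1 ∧ ∫ z, (z - tmean θ true) * tn θ true z = 0 ∧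
    ∫ z, (z - tmean θ true)^2 * tn θ true z = tvar θ true := by
    intro θ
    obtain ⟨i0, e0⟩ := tn_true_moments θ 1 0 0
    obtain ⟨i1, e1⟩ := tn_true_moments θ (-(nphi θ / nPhi θ)) 1 0
    obtain ⟨i2, e2⟩ := tn_true_moments θ ((nphi θ / nPhi θ)^2) (-2*(nphi θ / nPhi θ)) 1
    have f1 : (fun z => (z - tmean θ true) * tn θ true z) =
      fun z => (-(nphi θ / nPhi θ) + 1 * (z - θ) + 0 * (z - θ)^2) * tn θ true z := by
      funext z; simp only [tmean, if_true]; ring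
    have f2 : (fun z => (z - tmean θ true)^2 * tn θ true z) =
      fun z => ((nphi θ / nPhi θ)^2 + -2*(nphi θ / nPhi θ) * (z - θ) + 1 * (z - θ)^2) * tn θ true z := by
      funext z; simp only [tmean, if_true]; ring
    have f0 : (fun z => tn θ true z) =
      fun z => (1 + 0 * (z - θ) + 0 * (z - θ)^2) * tn θ true z := by
      funext z; ring
    rw [f1, f2, f0, e0, e1, e2]
    refine ⟨i1, i2, i0, by ring, by ring, ?_⟩
    simp only [tvar, gfun, if_true]; ring
  cases b
  · obtain ⟨i1, i2, i0, e0, e1, e2⟩ := key (-θ)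
    have f1 : (fun z => (z - tmean θ false) * tn θ false z) =
      fun z => -((fun z => (z - tmean (-θ) true) * tn (-θ) true z) (-z)) := by
      funext z; simp only [tmean_false, tn_false]; ring
    have f2 : (fun z => (z - tmean θ false)^2 * tn θ false z) =
      fun z => (fun z => (z - tmean (-θ) true)^2 * tn (-θ) true z) (-z) := by
      funext z; simp only [tmean_false, tn_false]; ring
    have f0 : (fun z => tn θ false z) =
      fun z => (fun z => tn (-θ) true z) (-z) := by
      funext z; simp only [tn_false]
    rw [f1, f2, f0]
    refine ⟨i1.comp_neg.neg, i2.comp_neg, i0.comp_neg, ?_, ?_, ?_⟩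
    · rw [integral_neg_eq_self (fun z => tn (-θ) true z)]; exact e0
    · rw [integral_neg, integral_neg_eq_self (fun z => (z - tmean (-θ) true) * tn (-θ) true z), e1]
      simp
    · rw [integral_neg_eq_self (fun z => (z - tmean (-θ) true)^2 * tn (-θ) true z), e2, tvar_false]
  · exact key θ

lemma tvar_nonneg (θ : ℝ) (b : Bool) : 0 ≤ tvar θ b := by
  obtain ⟨_, _, _, _, _, e⟩ := tn_moments θ b
  rw [← e]
  exact integral_nonneg fun z => mul_nonneg (sq_nonneg _) (tn_nonneg _ _ _)

lemma tmean_true_nonneg (θ : ℝ) : 0 ≤ tmean θ true := by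
  obtain ⟨i, e⟩ := tn_true_moments θ θ 1 0
  have : tmean θ true = ∫ z, (θ + 1 * (z - θ) + 0 * (z - θ)^2) * tn θ true z := by
    rw [e]; simp [tmean]
  rw [this]
  refine integral_nonneg fun z => ?_
  by_cases hz : 0 < z
  · exact mul_nonneg (by ring_nf; exact hz.le) (tn_nonneg _ _ _)
  · simp [tn, hz]

lemma gfun_nonneg (θ : ℝ) : 0 ≤ gfun θ := by
  have h := tmean_true_nonneg θ
  simp only [tmean, if_true] at h
  have : gfun θ = (nphi θ / nPhi θ) * (θ + nphi θ / nPhi θ) := by unfold gfun; ring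
  rw [this]
  have := nphi_pos θ
  have := nPhi_pos θ
  positivity

lemma tvar_le_one (θ : ℝ) (b : Bool) : tvar θ b ≤ 1 := by
  unfold tvar
  have h1 := gfun_nonneg θ
  have h2 := gfun_nonneg (-θ)
  split_ifs <;> linarith

lemma hasDerivAt_tmean (b : Bool) (θ : ℝ) : HasDerivAt (fun θ => tmean θ b) (tvar θ b) θ := by
  have key : ∀ θ, HasDerivAt (fun θ => tmean θ true) (tvar θ true) θ := by
    intro θ
    have hP := (nPhi_pos θ).ne'
    refine ((hasDerivAt_id θ).fun_add ((hasDerivAt_nphi θ).fun_div (hasDerivAt_nPhi θ) hP)).congr_deriv ?_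
    simp only [tvar, gfun, if_true]
    field_simp
    ring
  cases b
  · have h : (fun θ => tmean θ false) = fun θ => -tmean (-θ) true := funext tmean_false
    rw [h, tvar_false]
    exact (((key (-θ)).comp θ (hasDerivAt_neg θ)).fun_neg).congr_deriv (by ring)
  · exact key θ

lemma continuous_tmean (b : Bool) : Continuous (fun θ => tmean θ b) :=
  continuous_iff_continuousAt.2 fun x => (hasDerivAt_tmean b x).continuousAt

lemma measurable_tn (b : Bool) : Measurable (fun q : ℝ × ℝ => tn q.1 b q.2) := by
  have h1 : Measurable nphi := continuous_nphi.measurable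
  have h2 : Measurable nPhi := continuous_nPhi.measurable
  unfold tn
  cases b
  · simp only [Bool.false_eq_true, if_false]
    exact Measurable.ite (measurableSet_lt measurable_snd measurable_const) (by fun_prop) (by fun_prop)
  · simp only [if_true]
    exact Measurable.ite (measurableSet_lt measurable_const measurable_snd) (by fun_prop) (by fun_prop)

/-- one-dimensional density with mean `m` and variance `s` -/
structure MomDens (ρ : ℝ → ℝ) (m s : ℝ) : Prop where
  i0 : Integrable ρ
  i1 : Integrable (fun z => (z - m) * ρ z)
  i2 : Integrable (fun z => (z - m)^2 * ρ z)
  e0 : ∫ z, ρ z = 1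
  e1 : ∫ z, (z - m) * ρ z = 0
  e2 : ∫ z, (z - m)^2 * ρ z = s

section
variable {n : ℕ} {ρ : Fin n → ℝ → ℝ} {mu σ : Fin n → ℝ}

lemma prod_zero (h : ∀ i, MomDens (ρ i) (mu i) (σ i)) :
    Integrable (fun z : Fin n → ℝ => ∏ i, ρ i (z i)) ∧ ∫ z : Fin n → ℝ, ∏ i, ρ i (z i) = 1 := by
  constructor
  · exact Integrable.fintype_prod (fun i => (h i).i0)
  · rw [integral_fintype_prod_volume_eq_prod]; simp [(h _).e0]

lemma prod_one (h : ∀ i, MomDens (ρ i) (mu i) (σ i)) (i : Fin n) :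
    Integrable (fun z : Fin n → ℝ => (z i - mu i) * ∏ l, ρ l (z l)) ∧
    ∫ z : Fin n → ℝ, (z i - mu i) * ∏ l, ρ l (z l) = 0 := by
  have e : (fun z : Fin n → ℝ => (z i - mu i) * ∏ l, ρ l (z l)) =
      fun z => ∏ l, (fun l x => (if l = i then x - mu i else 1) * ρ l x) l (z l) := by
    funext z
    rw [Finset.prod_mul_distrib]; simp
  rw [e]
  constructor
  · refine Integrable.fintype_prod (f := fun l x => (if l = i then x - mu i else 1) * ρ l x) fun l => ?_
    by_cases hl : l = i
    · subst hl; simpa using (h l).i1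
    · simpa [hl] using (h l).i0
  · refine (integral_fintype_prod_volume_eq_prod (f := fun l x => (if l = i then x - mu i else 1) * ρ l x)).trans ?_
    refine Finset.prod_eq_zero (Finset.mem_univ i) ?_
    simpa using (h i).e1

lemma prod_two (h : ∀ i, MomDens (ρ i) (mu i) (σ i)) (i j : Fin n) :
    Integrable (fun z : Fin n → ℝ => (z i - mu i) * (z j - mu j) * ∏ l, ρ l (z l)) ∧
    ∫ z : Fin n → ℝ, (z i - mu i) * (z j - mu j) * ∏ l, ρ l (z l) = if i = j then σ i else 0 := by
  have e : (fun z : Fin n → ℝ => (z i - mu i) * (z j - mu j) * ∏ l, ρ l (z l)) =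
      fun z => ∏ l, (fun l x => (if l = i then x - mu i else 1) *
        (if l = j then x - mu j else 1) * ρ l x) l (z l) := by
    funext z
    rw [Finset.prod_mul_distrib, Finset.prod_mul_distrib]; simp
  rw [e]
  constructor
  · refine Integrable.fintype_prod (f := fun l x => (if l = i then x - mu i else 1) *
        (if l = j then x - mu j else 1) * ρ l x) fun l => ?_
    by_cases hl : l = i <;> by_cases hj : l = j
    · subst hl; subst hj; simpa [← pow_two] using (h l).i2
    · subst hl; simpa [hj] using (h l).i1
    · subst hj; simpa [hl] using (h l).i1
    · simpa [hl, hj] using (h l).i0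
  · refine (integral_fintype_prod_volume_eq_prod (f := fun l x => (if l = i then x - mu i else 1) *
        (if l = j then x - mu j else 1) * ρ l x)).trans ?_
    by_cases hij : i = j
    · subst hij
      rw [Finset.prod_eq_single i]
      · simpa [← pow_two] using (h i).e2
      · intro l _ hl
        simpa [hl] using (h l).e0
      · simp
    · refine (Finset.prod_eq_zero (Finset.mem_univ i) ?_).trans (by simp [hij])
      simpa [hij] using (h i).e1

lemma prod_moment {m : ℕ} (h : ∀ i, MomDens (ρ i) (mu i) (σ i))
    (A : Matrix (Fin m) (Fin n) ℝ) (b : Fin m → ℝ) :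
    Integrable (fun z : Fin n → ℝ => normSq (A *ᵥ z + b) * ∏ l, ρ l (z l)) ∧
    ∫ z : Fin n → ℝ, normSq (A *ᵥ z + b) * ∏ l, ρ l (z l)
      = ∑ i, (∑ k, A k i ^ 2) * σ i + normSq (A *ᵥ mu + b) := by
  set c : Fin m → ℝ := A *ᵥ mu + b with hc
  have e : (fun z : Fin n → ℝ => normSq (A *ᵥ z + b) * ∏ l, ρ l (z l)) = fun z =>
      ∑ k, ((∑ i, ∑ j, A k i * A k j * ((z i - mu i) * (z j - mu j) * ∏ l, ρ l (z l))) +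
        (∑ i, 2 * c k * A k i * ((z i - mu i) * ∏ l, ρ l (z l))) + c k ^ 2 * ∏ l, ρ l (z l)) := by
    funext z
    unfold normSq
    rw [Finset.sum_mul]
    refine Finset.sum_congr rfl fun k _ => ?_
    have h1 : (A *ᵥ z + b) k = (∑ i, A k i * (z i - mu i)) + c k := by
      simp only [hc, Pi.add_apply, mulVec, dotProduct, mul_sub, Finset.sum_sub_distrib]; ring
    have h2 : (∑ i, ∑ j, A k i * A k j * ((z i - mu i) * (z j - mu j) * ∏ l, ρ l (z l)))
        = (∑ i, A k i * (z i - mu i)) * (∑ i, A k i * (z i - mu i)) * ∏ l, ρ l (z l) := by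
      rw [Finset.sum_mul_sum, Finset.sum_mul]
      refine Finset.sum_congr rfl fun i _ => ?_
      rw [Finset.sum_mul]
      exact Finset.sum_congr rfl fun j _ => by ring
    have h3 : (∑ i, 2 * c k * A k i * ((z i - mu i) * ∏ l, ρ l (z l)))
        = 2 * c k * (∑ i, A k i * (z i - mu i)) * ∏ l, ρ l (z l) := by
      rw [Finset.mul_sum, Finset.sum_mul]
      exact Finset.sum_congr rfl fun j _ => by ring
    rw [h1, h2, h3]; ring
  rw [e]
  have I1 : ∀ k, Integrable (fun z : Fin n → ℝ =>
      ∑ i, ∑ j, A k i * A k j * ((z i - mu i) * (z j - mu j) * ∏ l, ρ l (z l))) := fun k =>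
    integrable_finsetSum _ fun i _ => integrable_finsetSum _ fun j _ =>
      (prod_two h i j).1.const_mul _
  have I2 : ∀ k, Integrable (fun z : Fin n → ℝ =>
      ∑ i, 2 * c k * A k i * ((z i - mu i) * ∏ l, ρ l (z l))) := fun k =>
    integrable_finsetSum _ fun i _ => (prod_one h i).1.const_mul _
  have I3 : ∀ k, Integrable (fun z : Fin n → ℝ => c k ^ 2 * ∏ l, ρ l (z l)) := fun k =>
    (prod_zero h).1.const_mul _
  have I4 : ∀ k, Integrable (fun z : Fin n → ℝ =>
      ((∑ i, ∑ j, A k i * A k j * ((z i - mu i) * (z j - mu j) * ∏ l, ρ l (z l))) +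
        (∑ i, 2 * c k * A k i * ((z i - mu i) * ∏ l, ρ l (z l))) + c k ^ 2 * ∏ l, ρ l (z l))) :=
    fun k => ((I1 k).add (I2 k)).add (I3 k)
  refine ⟨integrable_finsetSum _ fun k _ => I4 k, ?_⟩
  refine (integral_finsetSum _ fun k _ => I4 k).trans ?_
  have E : ∀ k, ∫ z : Fin n → ℝ, ((∑ i, ∑ j, A k i * A k j * ((z i - mu i) * (z j - mu j) * ∏ l, ρ l (z l))) +
        (∑ i, 2 * c k * A k i * ((z i - mu i) * ∏ l, ρ l (z l))) + c k ^ 2 * ∏ l, ρ l (z l))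
      = (∑ i, A k i ^ 2 * σ i) + c k ^ 2 := by
    intro k
    rw [integral_add (f := fun z : Fin n → ℝ => (∑ i, ∑ j, A k i * A k j * ((z i - mu i) * (z j - mu j) * ∏ l, ρ l (z l))) +
        (∑ i, 2 * c k * A k i * ((z i - mu i) * ∏ l, ρ l (z l)))) ((I1 k).add (I2 k)) (I3 k),
      integral_add (I1 k) (I2 k), integral_const_mul, (prod_zero h).2,
      integral_finsetSum _ fun i _ => (prod_one h i).1.const_mul _,
      integral_finsetSum _ fun i _ => integrable_finsetSum _ fun j _ => (prod_two h i j).1.const_mul _]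
    simp_rw [integral_finsetSum _ fun j _ => (prod_two h _ j).1.const_mul _, integral_const_mul,
      (prod_two h _ _).2, (prod_one h _).2]
    simp [pow_two]
  rw [Finset.sum_congr rfl fun k _ => E k, Finset.sum_add_distrib, Finset.sum_comm]
  simp only [normSq, Finset.sum_mul]
end

lemma momDens_nphi : MomDens nphi 0 1 := by
  have e1 : ∫ z, z * nphi z = 0 := by
    have := integral_neg_eq_self (fun z => z * nphi z) volume
    simp only [nphi_neg, neg_mul, integral_neg] at this
    linarith
  have e2 : ∫ z, z ^ 2 * nphi z = 1 := by
    have hd : ∀ z : ℝ, HasDerivAt (fun z => - (z * nphi z)) (z^2 * nphi z - nphi z) z := by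
      intro z
      exact (((hasDerivAt_id z).fun_mul (hasDerivAt_nphi z)).fun_neg).congr_deriv
        (by simp only [id]; ring)
    have := integral_eq_zero_of_hasDerivAt_of_integrable hd
      (integrable_sq_nphi.sub integrable_nphi) integrable_id_nphi.neg
    rw [integral_sub integrable_sq_nphi integrable_nphi, integral_nphi] at this
    linarith
  exact ⟨integrable_nphi, by simpa using integrable_id_nphi, by simpa using integrable_sq_nphi,
    integral_nphi, by simpa using e1, by simpa using e2⟩

lemma momDens_tn (θ : ℝ) (b : Bool) : MomDens (tn θ b) (tmean θ b) (tvar θ b) := by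
  obtain ⟨i1, i2, i0, e0, e1, e2⟩ := tn_moments θ b
  exact ⟨i0, i1, i2, e0, e1, e2⟩

/-- linear change of variables -/
lemma integral_comp_aff {p : ℕ} (S : Matrix (Fin p) (Fin p) ℝ) (hS : 0 < S.det) (μ : Fin p → ℝ)
    (g : (Fin p → ℝ) → ℝ) :
    ∫ x, S.det * g (S *ᵥ (x - μ)) = ∫ u, g u := by
  rw [integral_sub_right_eq_self (fun x => S.det * g (S *ᵥ x)) μ, integral_const_mul]
  have hm := Real.map_matrix_volume_pi_eq_smul_volume_pi (M := S) hS.ne'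
  have hu : IsUnit S.det := hS.ne'.isUnit
  have he : MeasurableEmbedding (fun x => S *ᵥ x) := by
    have hinv : ∀ x, S⁻¹ *ᵥ (S *ᵥ x) = x := fun x => by
      rw [mulVec_mulVec, nonsing_inv_mul _ hu, one_mulVec]
    have hinv2 : ∀ x, S *ᵥ (S⁻¹ *ᵥ x) = x := fun x => by
      rw [mulVec_mulVec, mul_nonsing_inv _ hu, one_mulVec]
    let e : (Fin p → ℝ) ≃ᵐ (Fin p → ℝ) :=
      { toFun := fun x => S *ᵥ x
        invFun := fun x => S⁻¹ *ᵥ x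
        left_inv := hinv
        right_inv := hinv2
        measurable_toFun := (Continuous.matrix_mulVec continuous_const continuous_id).measurable
        measurable_invFun := (Continuous.matrix_mulVec continuous_const continuous_id).measurable }
    exact e.measurableEmbedding
  have h2 := he.integral_map (μ := volume) g
  have h3 : (Measure.map (fun x => S *ᵥ x) volume) = ENNReal.ofReal |S.det⁻¹| • volume := by
    rw [← hm]; rfl
  rw [h3, integral_smul_measure, ENNReal.toReal_ofReal (abs_nonneg _), abs_of_pos (inv_pos.2 hS)] at h2
  rw [← h2, smul_eq_mul, ← mul_assoc, mul_inv_cancel₀ hS.ne', one_mul]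

lemma integrable_comp_aff {p : ℕ} (S : Matrix (Fin p) (Fin p) ℝ) (hS : 0 < S.det) (μ : Fin p → ℝ)
    (g : (Fin p → ℝ) → ℝ) (hg : Integrable g) :
    Integrable (fun x => S.det * g (S *ᵥ (x - μ))) := by
  refine Integrable.comp_sub_right (f := fun x => S.det * g (S *ᵥ x)) ?_ μ
  refine Integrable.const_mul ?_ _
  have hm := Real.map_matrix_volume_pi_eq_smul_volume_pi (M := S) hS.ne'
  have h3 : (Measure.map (fun x => S *ᵥ x) volume) = ENNReal.ofReal |S.det⁻¹| • volume := by
    rw [← hm]; rfl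
  have : Integrable g (Measure.map (fun x => S *ᵥ x) volume) := by
    rw [h3]; exact hg.smul_measure ENNReal.ofReal_ne_top
  exact this.comp_measurable (Continuous.matrix_mulVec continuous_const continuous_id).measurable

/-- A jointly measurable Markov transition density. -/
structure MD {A B : Type*} [MeasureSpace A] [MeasureSpace B] (k : A → B → ℝ) : Prop where
  meas : Measurable (Function.uncurry k)
  nonneg : ∀ x y, 0 ≤ k x y
  int : ∀ x, Integrable (k x)
  one : ∀ x, ∫ y, k x y = 1

/-- operator associated with a transition density -/
def op {A B : Type*} [MeasureSpace B] (k : A → B → ℝ) (f : B → ℝ) (x : A) : ℝ :=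
  ∫ y, k x y * f y

/-- bounded measurable function -/
structure BM {A : Type*} [MeasurableSpace A] (C : ℝ) (f : A → ℝ) : Prop where
  meas : Measurable f
  bdd : ∀ x, |f x| ≤ C

section
variable {A B D : Type*} [MeasureSpace A] [MeasureSpace B] [MeasureSpace D]

lemma BM.int {C : ℝ} {f : A → ℝ} (hf : BM C f) {ρ : A → ℝ} (hρ : Integrable ρ) :
    Integrable (fun x => ρ x * f x) :=
  hρ.mul_bdd hf.meas.aestronglyMeasurable (Eventually.of_forall hf.bdd)

variable [SFinite (volume : Measure A)] [SFinite (volume : Measure B)] [SFinite (volume : Measure D)]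

lemma op_bm {k : A → B → ℝ} (hk : MD k) {C : ℝ} {f : B → ℝ} (hf : BM C f) : BM C (op k f) := by
  constructor
  · have h : Measurable (Function.uncurry fun x y => k x y * f y) :=
      hk.meas.mul (hf.meas.comp measurable_snd)
    exact (h.stronglyMeasurable.integral_prod_right).measurable
  · intro x
    have h1 : |op k f x| ≤ ∫ y, |k x y * f y| := abs_integral_le_integral_abs
    have h2 : ∫ y, |k x y * f y| ≤ ∫ y, k x y * C := by
      refine integral_mono (hf.int (hk.int x)).abs ((hk.int x).mul_const C) fun y => ?_
      simp only [abs_mul, abs_of_nonneg (hk.nonneg x y)]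
      exact mul_le_mul_of_nonneg_left (hf.bdd y) (hk.nonneg x y)
    rw [integral_mul_const, hk.one, one_mul] at h2
    exact h1.trans h2

lemma joint_int {k : A → B → ℝ} (hk : MD k) {ρ : A → ℝ} (hρ : Integrable ρ) :
    Integrable (fun q : A × B => ρ q.1 * k q.1 q.2) := by
  have hm : AEStronglyMeasurable (fun q : A × B => ρ q.1 * k q.1 q.2) (volume.prod volume) :=
    (hρ.aestronglyMeasurable.comp_fst).mul hk.meas.aestronglyMeasurable
  refine (integrable_prod_iff hm).2 ⟨Eventually.of_forall fun x => (hk.int x).const_mul (ρ x), ?_⟩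
  refine hρ.norm.congr (Eventually.of_forall fun x => ?_)
  simp only [norm_mul]
  rw [integral_const_mul]
  have : ∀ y, ‖k x y‖ = k x y := fun y => by rw [Real.norm_eq_abs, abs_of_nonneg (hk.nonneg x y)]
  simp only [this, hk.one, mul_one]

lemma joint_int_f {k : A → B → ℝ} (hk : MD k) {ρ : A → ℝ} (hρ : Integrable ρ) {C : ℝ} {f : B → ℝ}
    (hf : BM C f) :
    Integrable (fun q : A × B => ρ q.1 * k q.1 q.2 * f q.2) :=
  (joint_int hk hρ).mul_bdd (hf.meas.comp measurable_snd).aestronglyMeasurable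
    (Eventually.of_forall fun q => hf.bdd q.2)

lemma op_swap {k : A → B → ℝ} (hk : MD k) {ρ : A → ℝ} (hρ : Integrable ρ) {C : ℝ} {f : B → ℝ}
    (hf : BM C f) :
    ∫ x, ρ x * op k f x = ∫ y, ∫ x, ρ x * k x y * f y := by
  rw [← integral_integral_swap (f := fun x y => ρ x * k x y * f y) (joint_int_f hk hρ hf)]
  congr 1; funext x
  unfold op
  rw [← integral_const_mul]
  congr 1; funext y; ring

lemma op_comp {k : A → B → ℝ} {l : B → D → ℝ} (hk : MD k) (hl : MD l) {C : ℝ} {f : D → ℝ}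
    (hf : BM C f) (x : A) :
    op (fun x y => ∫ z, k x z * l z y) f x = op k (op l f) x := by
  unfold op
  have := op_swap hl (hk.int x) hf
  unfold op at this
  rw [this]
  congr 1; funext y
  rw [integral_mul_const]

lemma MD.comp {k : A → B → ℝ} {l : B → D → ℝ} (hk : MD k) (hl : MD l) :
    MD (fun x y => ∫ z, k x z * l z y) := by
  refine ⟨?_, ?_, ?_, ?_⟩
  · have h : Measurable (Function.uncurry fun (q : A × D) (z : B) => k q.1 z * l z q.2) := by
      refine Measurable.mul ?_ ?_
      · exact hk.meas.comp (by fun_prop : Measurable fun w : (A × D) × B => (w.1.1, w.2))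
      · exact hl.meas.comp (by fun_prop : Measurable fun w : (A × D) × B => (w.2, w.1.2))
    exact (h.stronglyMeasurable.integral_prod_right).measurable
  · exact fun x y => integral_nonneg fun z => mul_nonneg (hk.nonneg _ _) (hl.nonneg _ _)
  · exact fun x => (joint_int hl (hk.int x)).integral_prod_right
  · intro x
    have h1 : BM 1 (fun _ : D => (1:ℝ)) := ⟨measurable_const, by simp⟩
    have := op_comp hk hl h1 x
    simp only [op, mul_one, hl.one, hk.one] at this
    exact this

lemma kIter_md {k : A → A → ℝ} (hk : MD k) (m : ℕ) : MD (kIter k m) := by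
  induction m with
  | zero => exact hk
  | succ m ih => exact ih.comp hk

lemma kIter_op {k : A → A → ℝ} (hk : MD k) (m : ℕ) {C : ℝ} {f : A → ℝ} (hf : BM C f) :
    op (kIter k m) f = (op k)^[m+1] f := by
  induction m generalizing f with
  | zero => rfl
  | succ m ih =>
    rw [Function.iterate_succ_apply, ← ih (op_bm hk hf)]
    funext x
    exact op_comp (kIter_md hk m) hk hf x

lemma young_rpow {s M h : ℝ} (hs0 : 0 ≤ s) (hs1 : s ≤ 1) (hM : 0 < M) (hh : 0 ≤ h) :
    h ^ s ≤ (1 - s) * M ^ s + s * M ^ s / M * h := by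
  have h1 := rpow_one_add_le_one_add_mul_self (s := h / M - 1)
    (by have : 0 ≤ h / M := by positivity
        linarith) hs0 hs1
  rw [show 1 + (h / M - 1) = h / M by ring, Real.div_rpow hh hM.le,
    div_le_iff₀ (Real.rpow_pos_of_pos hM s)] at h1
  calc h ^ s ≤ _ := h1
    _ = _ := by field_simp; ring

lemma core {ρ1 ρ2 V f : A → ℝ} (n1 : ∀ x, 0 ≤ ρ1 x) (n2 : ∀ x, 0 ≤ ρ2 x)
    (i1 : Integrable ρ1) (i2 : Integrable ρ2)
    (hV : ∀ x, 0 ≤ V x) (j1 : Integrable fun x => ρ1 x * V x) (j2 : Integrable fun x => ρ2 x * V x)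
    {a v1 v2 : ℝ} (ha : 0 < a) (m1 : ∫ x, ρ1 x = a) (m2 : ∫ x, ρ2 x = a)
    (b1 : ∫ x, ρ1 x * V x ≤ v1) (b2 : ∫ x, ρ2 x * V x ≤ v2)
    {C c s : ℝ} (hf : BM C f) (hc : 0 ≤ c) (hs0 : 0 ≤ s) (hs1 : s ≤ 1)
    (hosc : ∀ x y, f x - f y ≤ c * (1 + V x + V y) ^ s) :
    (∫ x, ρ1 x * f x) - ∫ x, ρ2 x * f x ≤ c * (a ^ (1 - s) * (a + v1 + v2) ^ s) := by
  have hv1 : 0 ≤ v1 := le_trans (integral_nonneg fun x => mul_nonneg (n1 x) (hV x)) b1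
  have hv2 : 0 ≤ v2 := le_trans (integral_nonneg fun x => mul_nonneg (n2 x) (hV x)) b2
  set M := (a + v1 + v2) / a with hM
  have hMpos : 0 < M := by positivity
  set u := c * ((1 - s) * M ^ s) with hu
  set w := c * (s * M ^ s / M) with hw
  have hw0 : 0 ≤ w := by positivity
  have hfxy : ∀ x y, f x - f y ≤ u + w * (1 + V x + V y) := by
    intro x y
    refine (hosc x y).trans ?_
    have := mul_le_mul_of_nonneg_left
      (young_rpow hs0 hs1 hMpos (by have := hV x; have := hV y; positivity : 0 ≤ 1 + V x + V y)) hc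
    refine this.trans (le_of_eq ?_)
    rw [hu, hw]; ring
  have step1 : ∀ y, (∫ x, ρ1 x * f x) - a * f y ≤ a * (u + w + w * V y) + w * (∫ x, ρ1 x * V x) := by
    intro y
    have e1 : ∫ x, (ρ1 x * f x - ρ1 x * f y) = (∫ x, ρ1 x * f x) - a * f y := by
      rw [integral_sub (hf.int i1) (i1.mul_const _), integral_mul_const, m1]
    have e2 : ∫ x, (ρ1 x * (u + w + w * V y) + w * (ρ1 x * V x))
        = a * (u + w + w * V y) + w * (∫ x, ρ1 x * V x) := by
      rw [integral_add (i1.mul_const _) (j1.const_mul _), integral_mul_const, m1, integral_const_mul]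
    rw [← e1, ← e2]
    refine integral_mono ((hf.int i1).sub (i1.mul_const _)) ((i1.mul_const _).add (j1.const_mul _))
      fun x => ?_
    have := mul_le_mul_of_nonneg_left (hfxy x y) (n1 x)
    simp only
    nlinarith
  have step2 : a * (∫ x, ρ1 x * f x) - a * (∫ x, ρ2 x * f x) ≤
      a * (a * (u + w) + w * (∫ x, ρ1 x * V x)) + a * (w * (∫ x, ρ2 x * V x)) := by
    set I1 := ∫ x, ρ1 x * f x
    set V1 := ∫ x, ρ1 x * V x
    have e1 : ∫ y, (ρ2 y * I1 - a * (ρ2 y * f y)) = a * I1 - a * (∫ x, ρ2 x * f x) := by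
      rw [integral_sub (i2.mul_const _) ((hf.int i2).const_mul _), integral_mul_const, m2,
        integral_const_mul]
    have e2 : ∫ y, (ρ2 y * (a * (u + w) + w * V1) + a * (w * (ρ2 y * V y)))
        = a * (a * (u + w) + w * V1) + a * (w * (∫ x, ρ2 x * V x)) := by
      rw [integral_add (i2.mul_const _) ((j2.const_mul _).const_mul _), integral_mul_const, m2,
        integral_const_mul, integral_const_mul]
    rw [← e1, ← e2]
    refine integral_mono ((i2.mul_const _).sub ((hf.int i2).const_mul _))
      ((i2.mul_const _).add ((j2.const_mul _).const_mul _)) fun y => ?_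
    have := mul_le_mul_of_nonneg_left (step1 y) (n2 y)
    simp only
    nlinarith
  have step3 : (∫ x, ρ1 x * f x) - ∫ x, ρ2 x * f x ≤
      a * (u + w) + w * (∫ x, ρ1 x * V x) + w * (∫ x, ρ2 x * V x) := by
    refine le_of_mul_le_mul_left ?_ ha
    linarith
  have step4 : a * (u + w) + w * (∫ x, ρ1 x * V x) + w * (∫ x, ρ2 x * V x) ≤ a * u + w * (a + v1 + v2) := by
    have := mul_le_mul_of_nonneg_left b1 hw0
    have := mul_le_mul_of_nonneg_left b2 hw0
    linarith
  have hMa : a + v1 + v2 = a * M := by rw [hM]; field_simp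
  have e : a * u + w * (a + v1 + v2) = c * (a ^ (1 - s) * (a + v1 + v2) ^ s) := by
    rw [hMa, Real.mul_rpow ha.le hMpos.le, ← mul_assoc (a ^ (1 - s)), ← Real.rpow_add ha,
      show 1 - s + s = 1 by ring, Real.rpow_one, hu, hw]
    field_simp
    ring
  linarith
end

section
variable {B Z : Type*} [MeasureSpace B] [MeasureSpace Z] [SFinite (volume : Measure B)]
  [SFinite (volume : Measure Z)]

/-- drift and minorization data -/
structure DM (τ : B → Z → ℝ) (q : Z → B → ℝ) (V : Z → ℝ) (U : B → ℝ) (L lam d eps : ℝ)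
    (ν : B → ℝ) : Prop where
  hτ : MD τ
  hq : MD q
  V0 : ∀ z, 0 ≤ V z
  U0 : ∀ β, 0 ≤ U β
  τi : ∀ β, Integrable fun z => τ β z * V z
  τb : ∀ β, ∫ z, τ β z * V z ≤ U β
  qi : ∀ z, Integrable fun β => q z β * U β
  qb : ∀ z, ∫ β, q z β * U β ≤ L + lam * V z
  νi : Integrable ν
  ν0 : ∀ β, 0 ≤ ν β
  ν1 : ∫ β, ν β = eps
  νle : ∀ z, V z ≤ d → ∀ β, ν β ≤ q z β

variable {τ : B → Z → ℝ} {q : Z → B → ℝ} {V : Z → ℝ} {U : B → ℝ} {L lam d eps : ℝ} {ν : B → ℝ}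

lemma DM.step1 (h : DM τ q V U L lam d eps ν) {C c s : ℝ} {f : Z → ℝ} (hf : BM C f) (hc : 0 ≤ c)
    (hs0 : 0 ≤ s) (hs1 : s ≤ 1) (hosc : ∀ x y, f x - f y ≤ c * (1 + V x + V y) ^ s) (x y : B) :
    op τ f x - op τ f y ≤ c * (1 + U x + U y) ^ s := by
  have := core (h.hτ.nonneg x) (h.hτ.nonneg y) (h.hτ.int x) (h.hτ.int y) h.V0 (h.τi x) (h.τi y)
    one_pos (h.hτ.one x) (h.hτ.one y) (h.τb x) (h.τb y) hf hc hs0 hs1 hosc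
  simpa [op] using this

lemma DM.step (h : DM τ q V U L lam d eps ν) (hL : 0 ≤ L) (hlam : 0 ≤ lam) (hlam1 : lam < 1)
    (hd : 0 ≤ d) (heps : eps < 1) {C c s γ A : ℝ} {f : Z → ℝ} (hf : BM C f)
    (hc : 0 ≤ c) (hs0 : 0 ≤ s) (hs1 : s ≤ 1)
    (hγ : γ = (1 + 2 * L + lam * d) / (1 + d)) (hA : A = 1 + 2 * (lam * d + L))
    (hs : (1 - eps) ^ (1 - s) * A ^ s = γ ^ s)
    (hosc : ∀ x y, f x - f y ≤ c * (1 + V x + V y) ^ s) (x y : Z) :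
    op q (op τ f) x - op q (op τ f) y ≤ c * γ ^ s * (1 + V x + V y) ^ s := by
  have h1 := h.step1 hf hc hs0 hs1 hosc
  have hF : BM C (op τ f) := op_bm h.hτ hf
  have hVx := h.V0 x
  have hVy := h.V0 y
  have hγ0 : 0 ≤ γ := by rw [hγ]; positivity
  rw [mul_assoc]
  by_cases hC : V x ≤ d ∧ V y ≤ d
  · obtain ⟨hx, hy⟩ := hC
    have ha : 0 < 1 - eps := by linarith
    have heps0 : 0 ≤ eps := by rw [← h.ν1]; exact integral_nonneg h.ν0
    have R : ∀ z, V z ≤ d → (∀ β, 0 ≤ q z β - ν β) ∧ Integrable (fun β => q z β - ν β) ∧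
        ∫ β, (q z β - ν β) = 1 - eps ∧ Integrable (fun β => (q z β - ν β) * U β) ∧
        ∫ β, (q z β - ν β) * U β ≤ L + lam * d := by
      intro z hz
      have a1 : ∀ β, 0 ≤ q z β - ν β := fun β => sub_nonneg.2 (h.νle z hz β)
      have hνU : Integrable (fun β => ν β * U β) := by
        have hUm : AEStronglyMeasurable (fun β => ν β * U β) volume := by
          have hqm := (h.hq.int z).aestronglyMeasurable
          have hν := h.νi.aestronglyMeasurable
          have hqU := (h.qi z).aestronglyMeasurable
          have e : (fun β => ν β * U β) = fun β => (ν β / q z β) * (q z β * U β) := by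
            funext β
            by_cases h0 : q z β = 0
            · have : ν β = 0 := le_antisymm (by rw [← h0]; exact h.νle z hz β) (h.ν0 β)
              simp [this]
            · field_simp
          rw [e]
          exact (hν.div₀ hqm).mul hqU
        refine (h.qi z).mono' hUm (Eventually.of_forall fun β => ?_)
        rw [Real.norm_eq_abs, abs_of_nonneg (mul_nonneg (h.ν0 β) (h.U0 β))]
        exact mul_le_mul_of_nonneg_right (h.νle z hz β) (h.U0 β)
      have e : (fun β => (q z β - ν β) * U β) = fun β => q z β * U β - ν β * U β := by
        funext β; ring
      refine ⟨a1, (h.hq.int z).sub h.νi, ?_, ?_, ?_⟩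
      · rw [integral_sub (h.hq.int z) h.νi, h.hq.one, h.ν1]
      · rw [e]; exact (h.qi z).sub hνU
      · rw [e, integral_sub (h.qi z) hνU]
        have := h.qb z
        have : 0 ≤ ∫ β, ν β * U β := integral_nonneg fun β => mul_nonneg (h.ν0 β) (h.U0 β)
        nlinarith
    obtain ⟨p1, p2, p3, p4, p5⟩ := R x hx
    obtain ⟨r1, r2, r3, r4, r5⟩ := R y hy
    have := core p1 r1 p2 r2 h.U0 p4 r4 ha p3 r3 p5 r5 hF hc hs0 hs1 h1
    have e : ∀ z, ∫ β, (q z β - ν β) * op τ f β = op q (op τ f) z - ∫ β, ν β * op τ f β := by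
      intro z
      simp only [sub_mul]
      rw [integral_sub (hF.int (h.hq.int z)) (hF.int h.νi)]; rfl
    rw [e, e] at this
    have h2 : (1 - eps) ^ (1 - s) * (1 - eps + (L + lam * d) + (L + lam * d)) ^ s ≤
        γ ^ s * (1 + V x + V y) ^ s := by
      calc _ ≤ (1 - eps) ^ (1 - s) * A ^ s := by
            refine mul_le_mul_of_nonneg_left ?_ (Real.rpow_nonneg ha.le _)
            refine Real.rpow_le_rpow (by positivity) ?_ hs0
            rw [hA]; linarith
        _ = γ ^ s * 1 := by rw [hs, mul_one]
        _ ≤ _ := by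
            refine mul_le_mul_of_nonneg_left ?_ (Real.rpow_nonneg hγ0 _)
            exact Real.one_le_rpow (by linarith) hs0
    have := mul_le_mul_of_nonneg_left h2 hc
    linarith
  · have hs' : d ≤ V x + V y := by
      by_contra hcon
      exact hC ⟨by linarith, by linarith⟩
    have := core (h.hq.nonneg x) (h.hq.nonneg y) (h.hq.int x) (h.hq.int y) h.U0 (h.qi x) (h.qi y)
      one_pos (h.hq.one x) (h.hq.one y) (h.qb x) (h.qb y) hF hc hs0 hs1 h1
    refine this.trans (mul_le_mul_of_nonneg_left ?_ hc)
    rw [Real.one_rpow, one_mul, ← Real.mul_rpow hγ0 (by positivity)]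
    refine Real.rpow_le_rpow (by positivity) ?_ hs0
    rw [hγ, div_mul_eq_mul_div, le_div_iff₀ (by positivity)]
    nlinarith [mul_nonneg (sub_nonneg.2 hs') (by linarith : 0 ≤ 1 + 2 * L - lam)]

lemma DM.iter (h : DM τ q V U L lam d eps ν) (hL : 0 ≤ L) (hlam : 0 ≤ lam) (hlam1 : lam < 1)
    (hd : 0 ≤ d) (heps : eps < 1) {C c s γ A : ℝ} {f : Z → ℝ} (hf : BM C f)
    (hc : 0 ≤ c) (hs0 : 0 ≤ s) (hs1 : s ≤ 1)
    (hγ : γ = (1 + 2 * L + lam * d) / (1 + d)) (hA : A = 1 + 2 * (lam * d + L))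
    (hs : (1 - eps) ^ (1 - s) * A ^ s = γ ^ s)
    (hosc : ∀ x y, f x - f y ≤ c * (1 + V x + V y) ^ s) (m : ℕ) :
    BM C ((fun g => op q (op τ g))^[m] f) ∧ ∀ x y,
    (fun g => op q (op τ g))^[m] f x - (fun g => op q (op τ g))^[m] f y
      ≤ c * (γ ^ s) ^ m * (1 + V x + V y) ^ s := by
  have hγ0 : 0 ≤ γ := by rw [hγ]; positivity
  induction m with
  | zero => exact ⟨hf, by simpa using hosc⟩
  | succ m ih =>
    rw [Function.iterate_succ_apply']
    refine ⟨op_bm h.hq (op_bm h.hτ ih.1), fun x y => ?_⟩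
    have := h.step hL hlam hlam1 hd heps ih.1
      (mul_nonneg hc (pow_nonneg (Real.rpow_nonneg hγ0 s) m)) hs0 hs1 hγ hA hs ih.2 x y
    rw [pow_succ, ← mul_assoc]
    exact this

theorem DM.final (h : DM τ q V U L lam d eps ν) (hL : 0 ≤ L) (hlam : 0 ≤ lam) (hlam1 : lam < 1)
    (hd : 0 ≤ d) (heps : eps < 1) {s γ A E : ℝ}
    (hs0 : 0 ≤ s) (hs1 : s ≤ 1 / 2)
    (hγ : γ = (1 + 2 * L + lam * d) / (1 + d)) (hA : A = 1 + 2 * (lam * d + L))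
    (hs : (1 - eps) ^ (1 - s) * A ^ s = γ ^ s)
    {π : B → ℝ} (πm : Measurable π) (πi : Integrable π) (π0 : ∀ x, 0 ≤ π x) (π1 : ∫ x, π x = 1)
    (hst : ∀ F : B → ℝ, BM 1 F → ∫ x, π x * op τ (op q F) x = ∫ x, π x * F x)
    (πU : Integrable fun x => π x * U x) (hE : ∫ x, π x * U x ≤ E)
    {k : B → B → ℝ} (hk : k = fun x y => ∫ z, τ x z * q z y) (m : ℕ) (β : B) :
    ∫ β', |kIter k m β β' - π β'| ≤ (2 + U β + E) * (γ ^ s) ^ m := by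
  have hkm : MD k := by rw [hk]; exact h.hτ.comp h.hq
  have hγ0 : 0 ≤ γ := by rw [hγ]; positivity
  have hopk : ∀ {f : B → ℝ}, BM 1 f → op k f = op τ (op q f) := fun hf => by
    funext x; rw [hk]; exact op_comp h.hτ h.hq hf x
  set F : B → ℝ := fun β' => if 0 ≤ kIter k m β β' - π β' then 1 else -1 with hFdef
  have hK := kIter_md hkm m
  have hF : BM 1 F := by
    constructor
    · refine Measurable.ite (measurableSet_le measurable_const ?_) measurable_const measurable_const
      exact (hK.meas.comp (by fun_prop : Measurable fun y : B => (β, y))).sub πm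
    · intro x; simp only [hFdef]; split_ifs <;> simp
  have e1 : ∫ β', |kIter k m β β' - π β'| = op (kIter k m) F β - ∫ x, π x * F x := by
    unfold op
    rw [← integral_sub (hF.int (hK.int β)) (hF.int πi)]
    congr 1; funext y
    simp only [hFdef]
    split_ifs with h0
    · rw [abs_of_nonneg h0]; ring
    · rw [abs_of_neg (not_le.1 h0)]; ring
  set f0 : Z → ℝ := op q F with hf0
  have hf0m : BM 1 f0 := op_bm h.hq hF
  have hosc0 : ∀ x y, f0 x - f0 y ≤ 2 * (1 + V x + V y) ^ s := by
    intro x y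
    have a1 := abs_le.1 (hf0m.bdd x)
    have a2 := abs_le.1 (hf0m.bdd y)
    have := Real.one_le_rpow (x := 1 + V x + V y) (z := s)
      (by linarith [h.V0 x, h.V0 y]) hs0
    linarith
  obtain ⟨hbm, hosc⟩ := h.iter hL hlam hlam1 hd heps hf0m (by norm_num) hs0 (by linarith) hγ hA hs
    hosc0 m
  set fm := (fun g => op q (op τ g))^[m] f0 with hfm
  have hKm : ∀ j, BM 1 ((op k)^[j] F) := by
    intro j
    induction j with
    | zero => exact hF
    | succ j ih => rw [Function.iterate_succ_apply']; exact op_bm hkm ih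
  have e2 : ∀ j, (op k)^[j+1] F = op τ ((fun g => op q (op τ g))^[j] f0) := by
    intro j
    induction j with
    | zero => simp [hopk hF, hf0]
    | succ j ih =>
      rw [Function.iterate_succ_apply', hopk (hKm _), ih, Function.iterate_succ_apply']
  have e3 : ∀ j, ∫ x, π x * (op k)^[j] F x = ∫ x, π x * F x := by
    intro j
    induction j with
    | zero => rfl
    | succ j ih =>
      rw [Function.iterate_succ_apply', hopk (hKm _), hst _ (hKm j), ih]
  rw [e1, kIter_op hkm m hF, ← e3 (m+1), e2]
  have hc : 0 ≤ 2 * (γ ^ s) ^ m := by positivity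
  have hG : BM 1 (op τ fm) := op_bm h.hτ hbm
  have s1 := h.step1 hbm hc hs0 (by linarith) hosc β
  have s2 : ∀ y, op τ fm β - op τ fm y ≤ (γ ^ s) ^ m * (2 + U β + U y) := by
    intro y
    refine (s1 y).trans ?_
    have hu := h.U0 β
    have hu2 := h.U0 y
    have := rpow_one_add_le_one_add_mul_self (s := U β + U y) (p := s)
      (by linarith) hs0 (by linarith)
    rw [← add_assoc] at this
    have h3 : (1 + U β + U y) ^ s ≤ (2 + U β + U y) / 2 := by
      have := mul_le_mul_of_nonneg_right hs1 (by linarith : 0 ≤ U β + U y)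
      linarith
    have := mul_le_mul_of_nonneg_left h3 hc
    linarith
  have s3 : ∫ y, (π y * op τ fm β - π y * op τ fm y) ≤
      ∫ y, (π y * ((γ ^ s) ^ m * (2 + U β)) + (γ ^ s) ^ m * (π y * U y)) := by
    refine integral_mono ((πi.mul_const _).sub (hG.int πi)) ((πi.mul_const _).add (πU.const_mul _))
      fun y => ?_
    have := mul_le_mul_of_nonneg_left (s2 y) (π0 y)
    simp only
    linarith
  rw [integral_sub (πi.mul_const _) (hG.int πi), integral_mul_const, π1, one_mul,
    integral_add (πi.mul_const _) (πU.const_mul _), integral_mul_const, π1, one_mul,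
    integral_const_mul] at s3
  have := mul_le_mul_of_nonneg_left hE (by positivity : 0 ≤ (γ ^ s) ^ m)
  linarith

/-- stationarity -/
lemma stationary (hτ : MD τ) (hq : MD q) {u : B → ℝ} (hu : Integrable u) {G : Z → ℝ}
    (hG : ∀ β z, u β * τ β z = q z β * G z) {C : ℝ} {F : B → ℝ} (hF : BM C F) :
    ∫ x, u x * op τ (op q F) x = ∫ x, u x * F x := by
  have hf := op_bm hq hF
  rw [op_swap hτ hu hf]
  have e1 : ∀ z, ∫ x, u x * τ x z * op q F z = ∫ x, u x * τ x z * F x := by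
    intro z
    simp only [hG]
    have : ∫ x, q z x * G z * op q F z = (∫ x, q z x) * (G z * op q F z) := by
      rw [← integral_mul_const]; congr 1; funext x; ring
    rw [this, hq.one, one_mul]
    unfold op
    rw [← integral_const_mul]
    congr 1; funext x; ring
  simp only [e1]
  have hIntg : Integrable (fun w : B × Z => u w.1 * τ w.1 w.2 * F w.1) :=
    (joint_int hτ hu).mul_bdd (hF.meas.comp measurable_fst).aestronglyMeasurable
    (Eventually.of_forall fun q => hF.bdd q.1)
  rw [← integral_integral_swap (f := fun x z => u x * τ x z * F x) hIntg]
  congr 1; funext x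
  rw [integral_mul_const, integral_const_mul, hτ.one, mul_one]

/-- a drift function is integrable with respect to the stationary density -/
lemma drift_integrable {W : B → ℝ} (hWm : Measurable W) (hW0 : ∀ x, 0 ≤ W x)
    {π : B → ℝ} (πi : Integrable π) (π0 : ∀ x, 0 ≤ π x) {b lam : ℝ}
    (hb : 0 ≤ b) (hlam1 : lam < 1) (π1 : ∫ x, π x = 1)
    {P : (B → ℝ) → B → ℝ}
    (hPm : ∀ N : ℕ, BM N (P fun x => min (W x) N))
    (hP : ∀ (N : ℕ) x, P (fun x => min (W x) N) x ≤ b + lam * W x)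
    (hst : ∀ N : ℕ, ∫ x, π x * P (fun x => min (W x) N) x = ∫ x, π x * min (W x) N) :
    Integrable (fun x => π x * W x) ∧ ∫ x, π x * W x ≤ b / (1 - lam) := by
  set φ : ℕ → Set B := fun N => {x | W x ≤ N} with hφ
  have hφm : ∀ N, MeasurableSet (φ N) := fun N => measurableSet_le hWm measurable_const
  have hcov : AECover (volume : Measure B) atTop φ := by
    refine ⟨Eventually.of_forall fun x => ?_, hφm⟩
    obtain ⟨N, hN⟩ := exists_nat_ge (W x)
    filter_upwards [eventually_ge_atTop N] with M hM
    exact hN.trans (by exact_mod_cast hM)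
  have hminm : ∀ N : ℕ, BM N (fun x => min (W x) N) := fun N =>
    ⟨hWm.min measurable_const, fun x => by
      rw [abs_of_nonneg (le_min (hW0 x) (Nat.cast_nonneg N))]; exact min_le_right _ _⟩
  have hi : ∀ N, IntegrableOn (fun x => π x * W x) (φ N) := by
    intro N
    refine (((hminm N).int πi).integrableOn (s := φ N)).congr_fun (fun x hx => ?_) (hφm N)
    simp only [min_eq_left (show W x ≤ N from hx)]
  have hbd : ∀ N, ∫ x in φ N, π x * W x ≤ b / (1 - lam) := by
    intro N
    have h1 : ∫ x, (π x * min (W x) N - π x * P (fun x => min (W x) N) x) = 0 := by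
      rw [integral_sub ((hminm N).int πi) ((hPm N).int πi), hst, sub_self]
    have h2 : ∫ x in φ N, ((1 - lam) * (π x * W x) - π x * b) ≤ 0 := by
      rw [← h1, ← integral_indicator (hφm N)]
      have hI : IntegrableOn (fun x => (1 - lam) * (π x * W x) - π x * b) (φ N) :=
        ((hi N).const_mul _).sub ((πi.mul_const _).integrableOn)
      refine integral_mono (hI.integrable_indicator (hφm N)) (((hminm N).int πi).sub ((hPm N).int πi)) fun x => ?_
      by_cases hx : x ∈ φ N
      · simp only [Set.indicator_of_mem hx, min_eq_left (show W x ≤ N from hx)]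
        have := mul_le_mul_of_nonneg_left (hP N x) (π0 x)
        linarith
      · simp only [Set.indicator_of_notMem hx]
        have hx' : (N:ℝ) < W x := not_le.1 hx
        rw [min_eq_right hx'.le]
        have := (abs_le.1 ((hPm N).bdd x)).2
        have := mul_le_mul_of_nonneg_left this (π0 x)
        linarith
    rw [integral_sub ((hi N).const_mul _) (πi.mul_const _).integrableOn, integral_const_mul,
      integral_mul_const] at h2
    have h3 : ∫ x in φ N, π x ≤ 1 := by
      rw [← π1]; exact setIntegral_le_integral πi (Eventually.of_forall π0)
    rw [le_div_iff₀ (by linarith)]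
    have := mul_le_mul_of_nonneg_right h3 hb
    linarith
  have hIntg := hcov.integrable_of_integral_bounded_of_nonneg_ae (b / (1 - lam)) hi
    (Eventually.of_forall fun x => mul_nonneg (π0 x) (hW0 x)) (Eventually.of_forall hbd)
  exact ⟨hIntg, le_of_tendsto (hcov.integral_tendsto_of_countably_generated hIntg)
    (Eventually.of_forall hbd)⟩
end

section linalg
variable {m n p : ℕ}

lemma normSq_eq (x : Fin m → ℝ) : normSq x = x ⬝ᵥ x := by
  simp [normSq, dotProduct, pow_two]

lemma normSq_nonneg' (x : Fin m → ℝ) : 0 ≤ normSq x :=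
  Finset.sum_nonneg fun _ _ => sq_nonneg _

lemma normSq_mulVec (A : Matrix (Fin m) (Fin n) ℝ) (x : Fin n → ℝ) :
    normSq (A *ᵥ x) = x ⬝ᵥ ((Aᵀ * A) *ᵥ x) := by
  rw [normSq_eq, ← mulVec_mulVec, dotProduct_mulVec x, vecMul_transpose]

lemma normSq_pos {x : Fin m → ℝ} (h : x ≠ 0) : 0 < normSq x := by
  rw [normSq_eq]
  refine lt_of_le_of_ne (by rw [← normSq_eq]; exact normSq_nonneg' x) ?_
  intro h0
  exact h (dotProduct_self_eq_zero.mp h0.symm)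

lemma normSq_sub (x y : Fin m → ℝ) :
    normSq (x - y) = normSq x - 2 * (x ⬝ᵥ y) + normSq y := by
  simp only [normSq_eq, sub_dotProduct, dotProduct_sub, dotProduct_comm y x]
  ring

lemma normSq_add (x y : Fin m → ℝ) :
    normSq (x + y) = normSq x + 2 * (x ⬝ᵥ y) + normSq y := by
  simp only [normSq_eq, add_dotProduct, dotProduct_add, dotProduct_comm y x]
  ring

lemma continuous_normSq : Continuous (normSq : (Fin m → ℝ) → ℝ) := by
  unfold normSq; fun_prop

lemma dot_sq_le (x y : Fin m → ℝ) : (x ⬝ᵥ y) ^ 2 ≤ normSq x * normSq y :=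
  Finset.sum_mul_sq_le_sq_mul_sq _ _ _

/-- the covariance inverse -/
abbrev Sg (X : Matrix (Fin n) (Fin p) ℝ) (Q : Matrix (Fin p) (Fin p) ℝ) :
    Matrix (Fin p) (Fin p) ℝ := Xᵀ * X + Q

structure Hyp (X : Matrix (Fin n) (Fin p) ℝ) (Q S T : Matrix (Fin p) (Fin p) ℝ) : Prop where
  hQ : Q.PosSemidef
  hSig : IsUnit (Sg X Q).det
  hS : S.PosSemidef
  hSS : S * S = Sg X Q
  hT : T.PosSemidef
  hTT : T * T = (Sg X Q)⁻¹

variable {X : Matrix (Fin n) (Fin p) ℝ} {Q S T : Matrix (Fin p) (Fin p) ℝ}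

lemma Hyp.Qt (h : Hyp X Q S T) : Qᵀ = Q := by simpa using h.hQ.1.eq
lemma Hyp.St (h : Hyp X Q S T) : Sᵀ = S := by simpa using h.hS.1.eq
lemma Hyp.Tt (h : Hyp X Q S T) : Tᵀ = T := by simpa using h.hT.1.eq
lemma Hyp.Sgt (h : Hyp X Q S T) : (Sg X Q)ᵀ = Sg X Q := by
  simp [Sg, transpose_mul, h.Qt]
lemma Hyp.Sgit (h : Hyp X Q S T) : (Sg X Q)⁻¹ᵀ = (Sg X Q)⁻¹ := by
  rw [transpose_nonsing_inv, h.Sgt]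

lemma Hyp.detsq (h : Hyp X Q S T) : S.det ^ 2 = (Sg X Q).det := by
  rw [← h.hSS, det_mul, pow_two]

lemma Hyp.detS (h : Hyp X Q S T) : 0 < S.det := by
  have h1 : 0 ≤ S.det := h.hS.det_nonneg
  refine lt_of_le_of_ne h1 fun h0 => ?_
  have := h.hSig.ne_zero
  rw [← h.detsq, ← h0] at this
  simp at this

lemma Hyp.nS (h : Hyp X Q S T) (x : Fin p → ℝ) : normSq (S *ᵥ x) = x ⬝ᵥ (Sg X Q *ᵥ x) := by
  rw [normSq_mulVec, h.St, h.hSS]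

lemma Hyp.nT (h : Hyp X Q S T) (y : Fin p → ℝ) :
    normSq (T *ᵥ y) = normSq (S *ᵥ ((Sg X Q)⁻¹ *ᵥ y)) := by
  rw [normSq_mulVec, h.Tt, h.hTT, h.nS, mulVec_mulVec, mul_nonsing_inv _ h.hSig, one_mulVec,
    dotProduct_comm]

lemma Hyp.nTS (h : Hyp X Q S T) (y : Fin p → ℝ) :
    normSq (T *ᵥ y) = y ⬝ᵥ ((Sg X Q)⁻¹ *ᵥ y) := by
  rw [normSq_mulVec, h.Tt, h.hTT]

lemma Hyp.qnn (h : Hyp X Q S T) (x : Fin p → ℝ) : 0 ≤ x ⬝ᵥ (Q *ᵥ x) := by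
  simpa using h.hQ.dotProduct_mulVec_nonneg x

lemma Hyp.nX (h : Hyp X Q S T) (x : Fin p → ℝ) :
    normSq (X *ᵥ x) ≤ normSq (S *ᵥ x) := by
  rw [h.nS, normSq_mulVec, add_mulVec, dotProduct_add]
  linarith [h.qnn x]

lemma Hyp.nTX (h : Hyp X Q S T) (w : Fin n → ℝ) :
    normSq (T *ᵥ (Xᵀ *ᵥ w)) ≤ normSq w := by
  set y := (Sg X Q)⁻¹ *ᵥ (Xᵀ *ᵥ w) with hy
  have e1 : normSq (T *ᵥ (Xᵀ *ᵥ w)) = w ⬝ᵥ (X *ᵥ y) := by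
    rw [h.nTS, ← hy, dotProduct_mulVec w, mulVec_transpose]
  have e2 : normSq (T *ᵥ (Xᵀ *ᵥ w)) = normSq (S *ᵥ y) := h.nT _
  have e3 := h.nX y
  have e4 := normSq_nonneg' (w - X *ᵥ y)
  rw [normSq_sub] at e4
  linarith

/-- the matrix whose columns describe the drift -/
def Am (X : Matrix (Fin n) (Fin p) ℝ) (Q S : Matrix (Fin p) (Fin p) ℝ) :
    Matrix (Fin p) (Fin n) ℝ := S * (Sg X Q)⁻¹ * Xᵀ

lemma Hyp.trace_eq (h : Hyp X Q S T) :
    trace (X * (Sg X Q)⁻¹ * Xᵀ) = ∑ i, ∑ k, Am X Q S k i ^ 2 := by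
  have e : X * (Sg X Q)⁻¹ * Xᵀ = (Am X Q S)ᵀ * Am X Q S := by
    unfold Am
    rw [transpose_mul, transpose_mul, transpose_transpose, h.Sgit, h.St]
    calc X * (Sg X Q)⁻¹ * Xᵀ = X * ((Sg X Q)⁻¹ * (Sg X Q) * (Sg X Q)⁻¹) * Xᵀ := by
          rw [nonsing_inv_mul _ h.hSig, Matrix.one_mul]
      _ = X * ((Sg X Q)⁻¹ * (S * S) * (Sg X Q)⁻¹) * Xᵀ := by rw [h.hSS]
      _ = _ := by simp only [Matrix.mul_assoc]
  rw [e, trace]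
  simp [Matrix.mul_apply, pow_two]

lemma Hyp.trace_nn (h : Hyp X Q S T) : 0 ≤ trace (X * (Sg X Q)⁻¹ * Xᵀ) := by
  rw [h.trace_eq]; positivity

lemma Hyp.trace_le (h : Hyp X Q S T) : trace (X * (Sg X Q)⁻¹ * Xᵀ) ≤ p := by
  have e1 : trace (X * (Sg X Q)⁻¹ * Xᵀ) = trace ((Sg X Q)⁻¹ * (Sg X Q - Q)) := by
    rw [Matrix.mul_assoc, trace_mul_comm, Matrix.mul_assoc]; simp [Sg]
  have e2 : trace ((Sg X Q)⁻¹ * Q) = trace (Tᴴ * Q * T) := by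
    rw [← h.hTT, Matrix.mul_assoc, trace_mul_comm, h.hT.1.eq]
  have e3 := (h.hQ.conjTranspose_mul_mul_same T).trace_nonneg
  rw [e1, Matrix.mul_sub, nonsing_inv_mul _ h.hSig, trace_sub, e2, trace_one, Fintype.card_fin]
  linarith

/-- conditional mean -/
def mu (X : Matrix (Fin n) (Fin p) ℝ) (v : Fin p → ℝ) (Q : Matrix (Fin p) (Fin p) ℝ)
    (z : Fin n → ℝ) : Fin p → ℝ := (Sg X Q)⁻¹ *ᵥ (Xᵀ *ᵥ z + Q *ᵥ v)

lemma phibar_eq (X : Matrix (Fin n) (Fin p) ℝ) (Y : Fin n → Bool) (β : Fin p → ℝ) (i : Fin n) :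
    phibar X Y β i = tmean (X i ⬝ᵥ β) (Y i) := rfl

lemma Hyp.mode (h : Hyp X Q S T) {Y : Fin n → Bool} {v Bhat : Fin p → ℝ}
    (hm : IsPosteriorMode X Y v Q Bhat) : mu X v Q (phibar X Y Bhat) = Bhat := by
  have e : Xᵀ *ᵥ (phibar X Y Bhat) + Q *ᵥ v = Sg X Q *ᵥ Bhat := by
    unfold IsPosteriorMode at hm
    set c : Fin n → ℝ := fun i =>
      (if Y i then nphi (dotProduct (X i) Bhat) / nPhi (dotProduct (X i) Bhat)
          else -(nphi (dotProduct (X i) Bhat) / (1 - nPhi (dotProduct (X i) Bhat)))) with hc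
    have e1 : phibar X Y Bhat = X *ᵥ Bhat + c := by
      funext i; rfl
    have e2 : Xᵀ *ᵥ c = ∑ i, c i • X i := by
      rw [mulVec_transpose, vecMul_eq_sum]
    rw [e1, mulVec_add, e2, add_mulVec, ← mulVec_mulVec]
    have hm' : ∑ i, c i • X i = Q *ᵥ (Bhat - v) := sub_eq_zero.mp hm
    rw [hm', mulVec_sub]
    abel
  unfold mu
  rw [e, mulVec_mulVec, nonsing_inv_mul _ h.hSig, one_mulVec]

/-- the set whose supremum is the contraction constant -/
def lamSet (X : Matrix (Fin n) (Fin p) ℝ) (Y : Fin n → Bool) (S T : Matrix (Fin p) (Fin p) ℝ)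
    (Bhat : Fin p → ℝ) : Set ℝ := {r : ℝ | ∃ t ∈ Set.Ioo (0 : ℝ) 1, ∃ α : Fin p → ℝ, α ≠ 0 ∧
      r = normSq ((T * Xᵀ * Dmat X Y (Bhat + t • α) * X).mulVec α) / normSq (S.mulVec α)}

lemma lamSet_nonneg (X : Matrix (Fin n) (Fin p) ℝ) (Y : Fin n → Bool)
    (S T : Matrix (Fin p) (Fin p) ℝ) (Bhat : Fin p → ℝ) : 0 ≤ sSup (lamSet X Y S T Bhat) := by
  refine Real.sSup_nonneg ?_
  rintro r ⟨t, _, α, _, rfl⟩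
  exact div_nonneg (normSq_nonneg' _) (normSq_nonneg' _)

lemma Dmat_eq (X : Matrix (Fin n) (Fin p) ℝ) (Y : Fin n → Bool) (β : Fin p → ℝ) :
    Dmat X Y β = Matrix.diagonal fun i => tvar (X i ⬝ᵥ β) (Y i) := rfl

lemma Hyp.ratio_le (h : Hyp X Q S T) (Y : Fin n → Bool) (β α : Fin p → ℝ) :
    normSq ((T * Xᵀ * Dmat X Y β * X) *ᵥ α) ≤ normSq (S *ᵥ α) := by
  have e : (T * Xᵀ * Dmat X Y β * X) *ᵥ α = T *ᵥ (Xᵀ *ᵥ (Dmat X Y β *ᵥ (X *ᵥ α))) := by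
    simp only [mulVec_mulVec, Matrix.mul_assoc]
  rw [e]
  refine (h.nTX _).trans (le_trans ?_ (h.nX α))
  rw [Dmat_eq]
  unfold normSq
  refine Finset.sum_le_sum fun i _ => ?_
  rw [mulVec_diagonal, mul_pow]
  have h1 := tvar_nonneg (X i ⬝ᵥ β) (Y i)
  have h2 := tvar_le_one (X i ⬝ᵥ β) (Y i)
  have h3 : tvar (X i ⬝ᵥ β) (Y i) ^ 2 ≤ 1 := by nlinarith
  have h4 := sq_nonneg ((X *ᵥ α) i)
  nlinarith

lemma Hyp.Sne (h : Hyp X Q S T) {α : Fin p → ℝ} (hα : α ≠ 0) : S *ᵥ α ≠ 0 := by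
  intro h0
  apply hα
  have : S⁻¹ *ᵥ (S *ᵥ α) = α := by
    rw [mulVec_mulVec, nonsing_inv_mul _ h.detS.ne'.isUnit, one_mulVec]
  rw [← this, h0, mulVec_zero]

lemma Hyp.lam_le (h : Hyp X Q S T) (Y : Fin n → Bool) (Bhat α : Fin p → ℝ) {t : ℝ}
    (ht : t ∈ Set.Ioo (0:ℝ) 1) :
    normSq ((T * Xᵀ * Dmat X Y (Bhat + t • α) * X) *ᵥ α) ≤
      sSup (lamSet X Y S T Bhat) * normSq (S *ᵥ α) := by
  by_cases hα : α = 0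
  · subst hα; simp [normSq]
  have hpos := normSq_pos (h.Sne hα)
  rw [← div_le_iff₀ hpos]
  refine le_csSup ⟨1, ?_⟩ ⟨t, ht, α, hα, rfl⟩
  rintro r ⟨t, _, α, hα, rfl⟩
  rw [div_le_one (normSq_pos (h.Sne hα))]
  exact h.ratio_le _ _ _

lemma Hyp.contr (h : Hyp X Q S T) {Y : Fin n → Bool} {v Bhat : Fin p → ℝ}
    (hm : IsPosteriorMode X Y v Q Bhat) (β : Fin p → ℝ) :
    normSq (S *ᵥ (mu X v Q (phibar X Y β) - Bhat)) ≤
      sSup (lamSet X Y S T Bhat) * normSq (S *ᵥ (β - Bhat)) := by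
  set α := β - Bhat with hα
  set u := T *ᵥ (Xᵀ *ᵥ (phibar X Y β - phibar X Y Bhat)) with hu
  have e0 : mu X v Q (phibar X Y β) - Bhat
      = (Sg X Q)⁻¹ *ᵥ (Xᵀ *ᵥ (phibar X Y β - phibar X Y Bhat)) := by
    conv_lhs => rw [← h.mode hm]
    unfold mu
    rw [← mulVec_sub, mulVec_sub Xᵀ]
    congr 1; abel
  have e1 : normSq (S *ᵥ (mu X v Q (phibar X Y β) - Bhat)) = normSq u := by
    rw [e0, hu, h.nT]
  rw [e1]
  set c : Fin n → ℝ := X *ᵥ (T *ᵥ u) with hc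
  have key : ∀ w : Fin n → ℝ, u ⬝ᵥ (T *ᵥ (Xᵀ *ᵥ w)) = ∑ i, c i * w i := by
    intro w
    rw [dotProduct_mulVec, dotProduct_mulVec, vecMul_transpose, ← mulVec_transpose, h.Tt]
    rfl
  have hder : ∀ t : ℝ, HasDerivAt (fun t => ∑ i, c i * phibar X Y (Bhat + t • α) i)
      (∑ i, c i * (tvar (X i ⬝ᵥ (Bhat + t • α)) (Y i) * (X i ⬝ᵥ α))) t := by
    intro t
    refine HasDerivAt.fun_sum fun i _ => HasDerivAt.const_mul _ ?_
    simp only [phibar_eq]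
    have h1 : HasDerivAt (fun t : ℝ => X i ⬝ᵥ (Bhat + t • α)) (X i ⬝ᵥ α) t := by
      simp only [dotProduct_add, dotProduct_smul, smul_eq_mul]
      exact (((hasDerivAt_id t).mul_const _).const_add _).congr_deriv (by simp)
    exact (hasDerivAt_tmean (Y i) (X i ⬝ᵥ (Bhat + t • α))).comp t h1
  obtain ⟨t, ht, hslope⟩ := exists_hasDerivAt_eq_slope
    (fun t => ∑ i, c i * phibar X Y (Bhat + t • α) i) _ zero_lt_one
    (fun t _ => (hder t).continuousAt.continuousWithinAt) (fun t _ => hder t)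
  set y := (T * Xᵀ * Dmat X Y (Bhat + t • α) * X) *ᵥ α with hy
  have e2 : ∑ i, c i * (tvar (X i ⬝ᵥ (Bhat + t • α)) (Y i) * (X i ⬝ᵥ α)) = u ⬝ᵥ y := by
    have : y = T *ᵥ (Xᵀ *ᵥ (Dmat X Y (Bhat + t • α) *ᵥ (X *ᵥ α))) := by
      rw [hy]; simp only [mulVec_mulVec, Matrix.mul_assoc]
    rw [this, key]
    refine Finset.sum_congr rfl fun i _ => ?_
    rw [Dmat_eq, mulVec_diagonal]; rfl
  have e3 : normSq u = u ⬝ᵥ y := by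
    rw [← e2, hslope, normSq_eq]
    have h1 : Bhat + (1:ℝ) • α = β := by rw [hα]; simp
    have h0 : Bhat + (0:ℝ) • α = Bhat := by simp
    rw [h1, h0]
    conv_lhs => rw [hu, ← hu]
    rw [show u ⬝ᵥ u = u ⬝ᵥ (T *ᵥ (Xᵀ *ᵥ (phibar X Y β - phibar X Y Bhat))) from rfl, key]
    simp [mul_sub, Finset.sum_sub_distrib]
  have e4 := dot_sq_le u y
  rw [← e3] at e4
  have e5 := h.lam_le Y Bhat α ht
  refine le_trans ?_ e5
  rcases (normSq_nonneg' u).eq_or_lt with h0 | h0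
  · rw [← h0]; exact normSq_nonneg' _
  · nlinarith

end linalg

section gauss
variable {n p : ℕ} {X : Matrix (Fin n) (Fin p) ℝ} {Q S T : Matrix (Fin p) (Fin p) ℝ}

/-- conditional density of the latent variable -/
def tauD (X : Matrix (Fin n) (Fin p) ℝ) (Y : Fin n → Bool) (β : Fin p → ℝ) (z : Fin n → ℝ) : ℝ :=
  ∏ i, tn (X i ⬝ᵥ β) (Y i) (z i)

/-- conditional density of the parameter -/
def qD (X : Matrix (Fin n) (Fin p) ℝ) (v : Fin p → ℝ) (Q : Matrix (Fin p) (Fin p) ℝ)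
    (z : Fin n → ℝ) (β : Fin p → ℝ) : ℝ := mvn (mu X v Q z) (Sg X Q)⁻¹ β

lemma prod_nphi (u : Fin p → ℝ) :
    ∏ i, nphi (u i) = ((Real.sqrt (2 * Real.pi))⁻¹) ^ p * Real.exp (-(normSq u) / 2) := by
  unfold nphi normSq
  rw [Finset.prod_mul_distrib, ← Real.exp_sum]
  simp [Finset.sum_div, neg_div]

lemma Hyp.qD_eq (h : Hyp X Q S T) (v : Fin p → ℝ) (z : Fin n → ℝ) (β : Fin p → ℝ) :
    qD X v Q z β = S.det * ∏ i, nphi ((S *ᵥ (β - mu X v Q z)) i) := by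
  unfold qD mvn
  rw [prod_nphi, nonsing_inv_nonsing_inv _ h.hSig, h.nS, ← mul_assoc]
  congr 1
  have hd := h.detS
  have : ((2 * Real.pi) ^ p * ((Sg X Q)⁻¹).det)⁻¹
      = (S.det * (Real.sqrt (2 * Real.pi))⁻¹ ^ p) ^ 2 := by
    rw [det_nonsing_inv, Ring.inverse_eq_inv', ← h.detsq, mul_pow S.det, ← pow_mul, mul_comm p 2,
      pow_mul, inv_pow (Real.sqrt _), Real.sq_sqrt (by positivity)]
    rw [mul_inv, inv_inv, inv_pow]; ring
  rw [this, Real.sqrt_sq (by positivity)]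

lemma Hyp.qD_pos (h : Hyp X Q S T) (v : Fin p → ℝ) (z : Fin n → ℝ) (β : Fin p → ℝ) :
    0 < qD X v Q z β := by
  rw [h.qD_eq]
  exact mul_pos h.detS (Finset.prod_pos fun _ _ => nphi_pos _)

lemma continuous_mu (X : Matrix (Fin n) (Fin p) ℝ) (v : Fin p → ℝ)
    (Q : Matrix (Fin p) (Fin p) ℝ) : Continuous (mu X v Q) := by
  unfold mu
  exact Continuous.matrix_mulVec continuous_const
    ((Continuous.matrix_mulVec continuous_const continuous_id).add continuous_const)

lemma Hyp.MDq (h : Hyp X Q S T) (v : Fin p → ℝ) : MD (qD X v Q) := by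
  have hp := prod_zero (n := p) (fun _ => momDens_nphi)
  refine ⟨?_, fun z β => (h.qD_pos v z β).le, fun z => ?_, fun z => ?_⟩
  · have : Function.uncurry (qD X v Q) = fun q : (Fin n → ℝ) × (Fin p → ℝ) =>
        S.det * ∏ i, nphi ((S *ᵥ (q.2 - mu X v Q q.1)) i) := by
      funext q; exact h.qD_eq v q.1 q.2
    rw [this]
    have hc : Continuous fun q : (Fin n → ℝ) × (Fin p → ℝ) => S *ᵥ (q.2 - mu X v Q q.1) :=
      Continuous.matrix_mulVec continuous_const
        (continuous_snd.sub ((continuous_mu X v Q).comp continuous_fst))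
    refine Continuous.measurable ?_
    refine continuous_const.mul (continuous_finsetProd _ fun i _ => ?_)
    exact continuous_nphi.comp ((continuous_apply i).comp hc)
  · have := integrable_comp_aff S h.detS (mu X v Q z) _ hp.1
    exact this.congr (Eventually.of_forall fun β => (h.qD_eq v z β).symm)
  · simp only [h.qD_eq v z]
    exact (integral_comp_aff S h.detS (mu X v Q z) (fun u => ∏ i, nphi (u i))).trans hp.2

/-- second moment under the Gaussian -/
lemma Hyp.qW (h : Hyp X Q S T) (v Bhat : Fin p → ℝ) (z : Fin n → ℝ) :
    Integrable (fun β => qD X v Q z β * normSq (S *ᵥ (β - Bhat))) ∧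
    ∫ β, qD X v Q z β * normSq (S *ᵥ (β - Bhat))
      = p + normSq (S *ᵥ (mu X v Q z - Bhat)) := by
  set b := S *ᵥ (mu X v Q z - Bhat) with hb
  have hp := prod_moment (n := p) (fun _ => momDens_nphi) (1 : Matrix (Fin p) (Fin p) ℝ) b
  have e : (fun β => qD X v Q z β * normSq (S *ᵥ (β - Bhat))) = fun β =>
      S.det * (fun u : Fin p → ℝ => normSq ((1 : Matrix (Fin p) (Fin p) ℝ) *ᵥ u + b) *
        ∏ i, nphi (u i)) (S *ᵥ (β - mu X v Q z)) := by
    funext β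
    rw [h.qD_eq]
    have : S *ᵥ (β - Bhat) = (1 : Matrix (Fin p) (Fin p) ℝ) *ᵥ (S *ᵥ (β - mu X v Q z)) + b := by
      rw [one_mulVec, hb, ← mulVec_add]; congr 1; abel
    rw [this]; ring
  rw [e]
  refine ⟨integrable_comp_aff S h.detS _ _ hp.1, ?_⟩
  refine (integral_comp_aff S h.detS (mu X v Q z)
    (fun u : Fin p → ℝ => normSq ((1 : Matrix (Fin p) (Fin p) ℝ) *ᵥ u + b) *
        ∏ i, nphi (u i))).trans ?_
  refine hp.2.trans ?_
  have h1 : ∀ i : Fin p, ∑ k, ((1 : Matrix (Fin p) (Fin p) ℝ) k i) ^ 2 = 1 := by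
    intro i; simp [Matrix.one_apply]
  have h2 : (1 : Matrix (Fin p) (Fin p) ℝ) *ᵥ (fun _ : Fin p => (0:ℝ)) = 0 := by
    rw [one_mulVec]; rfl
  simp [h1, h2]

lemma MDtau (X : Matrix (Fin n) (Fin p) ℝ) (Y : Fin n → Bool) : MD (tauD X Y) := by
  refine ⟨?_, fun β z => Finset.prod_nonneg fun i _ => tn_nonneg _ _ _, fun β => ?_, fun β => ?_⟩
  · have : Function.uncurry (tauD X Y) = fun q : (Fin p → ℝ) × (Fin n → ℝ) =>
        ∏ i, tn (X i ⬝ᵥ q.1) (Y i) (q.2 i) := rfl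
    rw [this]
    refine Finset.measurable_fun_prod _ fun i _ => ?_
    refine (measurable_tn (Y i)).comp (f := fun q : (Fin p → ℝ) × (Fin n → ℝ) =>
      (X i ⬝ᵥ q.1, q.2 i)) ?_
    refine Measurable.prodMk ?_ ?_
    · refine Continuous.measurable ?_
      exact Continuous.dotProduct continuous_const continuous_fst
    · exact (measurable_pi_apply i).comp measurable_snd
  · exact (prod_zero (fun i => momDens_tn (X i ⬝ᵥ β) (Y i))).1
  · exact (prod_zero (fun i => momDens_tn (X i ⬝ᵥ β) (Y i))).2

/-- drift function on the parameter space -/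
def Ufun (X : Matrix (Fin n) (Fin p) ℝ) (Y : Fin n → Bool) (v : Fin p → ℝ)
    (Q S : Matrix (Fin p) (Fin p) ℝ) (Bhat β : Fin p → ℝ) : ℝ :=
  trace (X * (Sg X Q)⁻¹ * Xᵀ) + normSq (S *ᵥ (mu X v Q (phibar X Y β) - Bhat))

lemma Hyp.tauV (h : Hyp X Q S T) (Y : Fin n → Bool) (v Bhat β : Fin p → ℝ) :
    Integrable (fun z => tauD X Y β z * normSq (S *ᵥ (mu X v Q z - Bhat))) ∧
    ∫ z, tauD X Y β z * normSq (S *ᵥ (mu X v Q z - Bhat)) ≤ Ufun X Y v Q S Bhat β := by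
  set b := S *ᵥ ((Sg X Q)⁻¹ *ᵥ (Q *ᵥ v) - Bhat) with hb
  have hz : ∀ z, S *ᵥ (mu X v Q z - Bhat) = Am X Q S *ᵥ z + b := by
    intro z
    unfold mu Am
    rw [hb, ← mulVec_mulVec, ← mulVec_mulVec, ← mulVec_add, mulVec_add (Sg X Q)⁻¹]
    congr 1; abel
  have hp := prod_moment (fun i => momDens_tn (X i ⬝ᵥ β) (Y i)) (Am X Q S) b
  unfold Ufun
  simp only [hz, mul_comm (tauD X Y β _)]
  refine ⟨hp.1, hp.2.le.trans ?_⟩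
  rw [h.trace_eq]
  refine add_le_add ?_ le_rfl
  refine Finset.sum_le_sum fun i _ => ?_
  have : (0:ℝ) ≤ ∑ k, Am X Q S k i ^ 2 := by positivity
  exact mul_le_of_le_one_right this (tvar_le_one _ _)

lemma continuous_phibar (X : Matrix (Fin n) (Fin p) ℝ) (Y : Fin n → Bool) :
    Continuous (phibar X Y) := by
  refine continuous_pi fun i => ?_
  have : (fun β => phibar X Y β i) = fun β => tmean (X i ⬝ᵥ β) (Y i) := rfl
  rw [this]
  exact (continuous_tmean (Y i)).comp (Continuous.dotProduct continuous_const continuous_id)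

lemma continuous_quad (S : Matrix (Fin p) (Fin p) ℝ) (Bhat : Fin p → ℝ) :
    Continuous fun β : Fin p → ℝ => normSq (S *ᵥ (β - Bhat)) :=
  continuous_normSq.comp
    (Continuous.matrix_mulVec continuous_const (continuous_id.sub continuous_const))

lemma continuous_Ufun (X : Matrix (Fin n) (Fin p) ℝ) (Y : Fin n → Bool) (v : Fin p → ℝ)
    (Q S : Matrix (Fin p) (Fin p) ℝ) (Bhat : Fin p → ℝ) : Continuous (Ufun X Y v Q S Bhat) := by
  unfold Ufun
  exact continuous_const.add
    ((continuous_quad S Bhat).comp ((continuous_mu X v Q).comp (continuous_phibar X Y)))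

lemma Hyp.U0 (h : Hyp X Q S T) (Y : Fin n → Bool) (v Bhat β : Fin p → ℝ) :
    0 ≤ Ufun X Y v Q S Bhat β := add_nonneg h.trace_nn (normSq_nonneg' _)

lemma Hyp.Ule (h : Hyp X Q S T) {Y : Fin n → Bool} {v Bhat : Fin p → ℝ}
    (hm : IsPosteriorMode X Y v Q Bhat) (β : Fin p → ℝ) :
    Ufun X Y v Q S Bhat β ≤ trace (X * (Sg X Q)⁻¹ * Xᵀ) +
      sSup (lamSet X Y S T Bhat) * normSq (S *ᵥ (β - Bhat)) :=
  add_le_add le_rfl (h.contr hm β)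

lemma Hyp.qU (h : Hyp X Q S T) {Y : Fin n → Bool} {v Bhat : Fin p → ℝ}
    (hm : IsPosteriorMode X Y v Q Bhat) (z : Fin n → ℝ) :
    Integrable (fun β => qD X v Q z β * Ufun X Y v Q S Bhat β) ∧
    ∫ β, qD X v Q z β * Ufun X Y v Q S Bhat β ≤ p * (1 + sSup (lamSet X Y S T Bhat)) +
      sSup (lamSet X Y S T Bhat) * normSq (S *ᵥ (mu X v Q z - Bhat)) := by
  set lam := sSup (lamSet X Y S T Bhat) with hl
  have hq := h.MDq v
  have hW := h.qW v Bhat z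
  set tr := trace (X * (Sg X Q)⁻¹ * Xᵀ) with htr
  have hdom : Integrable fun β => tr * qD X v Q z β +
      lam * (qD X v Q z β * normSq (S *ᵥ (β - Bhat))) :=
    ((hq.int z).const_mul tr).add (hW.1.const_mul lam)
  have hle : ∀ β, qD X v Q z β * Ufun X Y v Q S Bhat β ≤ tr * qD X v Q z β +
      lam * (qD X v Q z β * normSq (S *ᵥ (β - Bhat))) := by
    intro β
    have := mul_le_mul_of_nonneg_left (h.Ule hm β) (hq.nonneg z β)
    refine this.trans (le_of_eq ?_)
    ring
  have hIntg : Integrable (fun β => qD X v Q z β * Ufun X Y v Q S Bhat β) := by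
    refine hdom.mono' ?_ (Eventually.of_forall fun β => ?_)
    · exact (hq.int z).aestronglyMeasurable.mul (continuous_Ufun X Y v Q S Bhat).aestronglyMeasurable
    · rw [Real.norm_of_nonneg (mul_nonneg (hq.nonneg z β) (h.U0 Y v Bhat β))]
      exact hle β
  refine ⟨hIntg, (integral_mono hIntg hdom hle).trans ?_⟩
  rw [integral_add ((hq.int z).const_mul tr) (hW.1.const_mul lam), integral_const_mul,
    integral_const_mul, hq.one, hW.2]
  have := h.trace_le
  rw [← htr] at this
  linarith

/-- minorizing function -/
def nuD (S : Matrix (Fin p) (Fin p) ℝ) (d : ℝ) (Bhat β : Fin p → ℝ) : ℝ :=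
  S.det * (Real.exp (-d) * ∏ i, ((Real.sqrt (2 * Real.pi))⁻¹ *
    Real.exp (-1 * ((S *ᵥ (β - Bhat)) i) ^ 2)))

lemma nu_one :
    ∫ x : ℝ, ((Real.sqrt (2 * Real.pi))⁻¹ * Real.exp (-1 * x ^ 2)) = (2:ℝ) ^ (-(1:ℝ) / 2) := by
  rw [integral_const_mul, integral_gaussian, div_one, Real.sqrt_mul (by norm_num), neg_div,
    Real.rpow_neg (by norm_num), ← Real.sqrt_eq_rpow]
  have : Real.sqrt Real.pi ≠ 0 := (Real.sqrt_pos.mpr Real.pi_pos).ne'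
  field_simp

lemma Hyp.nu (h : Hyp X Q S T) (d : ℝ) (Bhat : Fin p → ℝ) :
    Integrable (nuD S d Bhat) ∧
    ∫ β, nuD S d Bhat β = (2 : ℝ) ^ (-(p : ℝ) / 2) * Real.exp (-d) := by
  have hi : Integrable (fun u : Fin p → ℝ => Real.exp (-d) * ∏ i, ((Real.sqrt (2 * Real.pi))⁻¹ *
    Real.exp (-1 * (u i) ^ 2))) := by
    refine Integrable.const_mul ?_ _
    exact Integrable.fintype_prod (f := fun _ x => (Real.sqrt (2 * Real.pi))⁻¹ *
      Real.exp (-1 * x ^ 2)) (fun i => (integrable_exp_neg_mul_sq one_pos).const_mul _)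
  refine ⟨integrable_comp_aff S h.detS Bhat _ hi, ?_⟩
  refine (integral_comp_aff S h.detS Bhat (fun u : Fin p → ℝ => Real.exp (-d) *
    ∏ i, ((Real.sqrt (2 * Real.pi))⁻¹ * Real.exp (-1 * (u i) ^ 2)))).trans ?_
  rw [integral_const_mul]
  rw [integral_fintype_prod_volume_eq_prod (f := fun (_ : Fin p) (x : ℝ) =>
    (Real.sqrt (2 * Real.pi))⁻¹ * Real.exp (-1 * x ^ 2))]
  rw [nu_one, Finset.prod_const, Finset.card_univ, Fintype.card_fin, mul_comm,
    ← Real.rpow_natCast, ← Real.rpow_mul (by norm_num)]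
  congr 2; ring

lemma Hyp.nu_le (h : Hyp X Q S T) {d : ℝ} (v Bhat : Fin p → ℝ) (z : Fin n → ℝ)
    (hz : normSq (S *ᵥ (mu X v Q z - Bhat)) ≤ d) (β : Fin p → ℝ) :
    nuD S d Bhat β ≤ qD X v Q z β := by
  rw [h.qD_eq, prod_nphi]
  unfold nuD
  refine mul_le_mul_of_nonneg_left ?_ h.detS.le
  rw [Finset.prod_mul_distrib, Finset.prod_const, Finset.card_univ, Fintype.card_fin,
    ← Real.exp_sum, mul_left_comm, ← Real.exp_add]
  refine mul_le_mul_of_nonneg_left (Real.exp_le_exp.mpr ?_) (by positivity)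
  have e1 : ∑ i, -1 * (S *ᵥ (β - Bhat)) i ^ 2 = - normSq (S *ᵥ (β - Bhat)) := by
    simp [normSq]
  have e2 : S *ᵥ (β - mu X v Q z) = S *ᵥ (β - Bhat) - S *ᵥ (mu X v Q z - Bhat) := by
    rw [← mulVec_sub]; congr 1; abel
  rw [e1, e2]
  have e3 := normSq_nonneg' (S *ᵥ (β - Bhat) + S *ᵥ (mu X v Q z - Bhat))
  rw [normSq_add] at e3
  rw [normSq_sub]
  linarith

lemma Hyp.DM (h : Hyp X Q S T) {Y : Fin n → Bool} {v Bhat : Fin p → ℝ}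
    (hm : IsPosteriorMode X Y v Q Bhat) (d : ℝ) :
    DM (tauD X Y) (qD X v Q) (fun z => normSq (S *ᵥ (mu X v Q z - Bhat)))
      (Ufun X Y v Q S Bhat) (p * (1 + sSup (lamSet X Y S T Bhat))) (sSup (lamSet X Y S T Bhat)) d
      ((2 : ℝ) ^ (-(p : ℝ) / 2) * Real.exp (-d)) (nuD S d Bhat) where
  hτ := MDtau X Y
  hq := h.MDq v
  V0 := fun _ => normSq_nonneg' _
  U0 := h.U0 Y v Bhat
  τi := fun β => (h.tauV Y v Bhat β).1
  τb := fun β => (h.tauV Y v Bhat β).2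
  qi := fun z => (h.qU hm z).1
  qb := fun z => (h.qU hm z).2
  νi := (h.nu d Bhat).1
  ν0 := fun β => by
    have := h.detS
    unfold nuD; positivity
  ν1 := (h.nu d Bhat).2
  νle := fun z hz β => h.nu_le v Bhat z hz β

end gauss

section post
variable {n p : ℕ} {X : Matrix (Fin n) (Fin p) ℝ} {Q S T : Matrix (Fin p) (Fin p) ℝ}

lemma Hyp.complete (h : Hyp X Q S T) (v β : Fin p → ℝ) (z : Fin n → ℝ) :
    normSq (z - X *ᵥ β) + (β - v) ⬝ᵥ (Q *ᵥ (β - v)) =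
      normSq (S *ᵥ (β - mu X v Q z)) +
        (normSq z + v ⬝ᵥ (Q *ᵥ v) - normSq (S *ᵥ mu X v Q z)) := by
  have e1 : (S *ᵥ β) ⬝ᵥ (S *ᵥ mu X v Q z) = z ⬝ᵥ (X *ᵥ β) + β ⬝ᵥ (Q *ᵥ v) := by
    rw [dotProduct_comm, dotProduct_mulVec, ← mulVec_transpose, h.St, mulVec_mulVec, h.hSS]
    unfold mu
    rw [mulVec_mulVec, mul_nonsing_inv _ h.hSig, one_mulVec, add_dotProduct,
      dotProduct_comm _ β, dotProduct_comm _ β, dotProduct_mulVec z, mulVec_transpose,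
      dotProduct_comm β]
  have e2 : v ⬝ᵥ (Q *ᵥ β) = β ⬝ᵥ (Q *ᵥ v) := by
    rw [dotProduct_mulVec, ← mulVec_transpose, h.Qt, dotProduct_comm]
  have e3 : normSq (S *ᵥ β) = normSq (X *ᵥ β) + β ⬝ᵥ (Q *ᵥ β) := by
    rw [h.nS, normSq_mulVec, add_mulVec, dotProduct_add]
  rw [mulVec_sub S, normSq_sub, normSq_sub, e1, e3]
  simp only [mulVec_sub, sub_dotProduct, dotProduct_sub, e2]
  ring

/-- sign indicator -/
def ind (b : Bool) (z : ℝ) : ℝ := if b then (if 0 < z then 1 else 0) else (if z < 0 then 1 else 0)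

lemma ind_tn (θ : ℝ) (b : Bool) (z : ℝ) :
    (if b then nPhi θ else 1 - nPhi θ) * tn θ b z = ind b z * nphi (z - θ) := by
  have h1 := nPhi_pos θ
  have h2 : 0 < 1 - nPhi θ := sub_pos.mpr (nPhi_lt_one θ)
  unfold tn ind
  cases b
  · by_cases hz : z < 0
    · simp [hz]; field_simp
    · simp [hz]
  · by_cases hz : 0 < z
    · simp [hz]; field_simp
    · simp [hz]

lemma Hyp.joint (h : Hyp X Q S T) (Y : Fin n → Bool) (v : Fin p → ℝ) :
    ∃ G : (Fin n → ℝ) → ℝ, ∀ β z, postUnnorm X Y v Q β * tauD X Y β z = qD X v Q z β * G z := by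
  set c := S.det * (Real.sqrt (2 * Real.pi))⁻¹ ^ p with hc
  have hc0 : c ≠ 0 := by
    have := h.detS
    positivity
  refine ⟨fun z => (∏ i, ind (Y i) (z i)) * ((Real.sqrt (2 * Real.pi))⁻¹ ^ n *
    Real.exp (-(normSq z + v ⬝ᵥ (Q *ᵥ v) - normSq (S *ᵥ mu X v Q z)) / 2)) / c, fun β z => ?_⟩
  have e1 : postUnnorm X Y v Q β * tauD X Y β z =
      (∏ i, ind (Y i) (z i)) * (∏ i, nphi ((z - X *ᵥ β) i)) *
        Real.exp (-((β - v) ⬝ᵥ (Q *ᵥ (β - v))) / 2) := by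
    unfold postUnnorm tauD
    rw [mul_right_comm, ← Finset.prod_mul_distrib, ← Finset.prod_mul_distrib]
    congr 1
    exact Finset.prod_congr rfl fun i _ => ind_tn _ _ _
  have e2 : Real.exp (-(normSq (z - X *ᵥ β)) / 2) * Real.exp (-((β - v) ⬝ᵥ (Q *ᵥ (β - v))) / 2)
      = Real.exp (-(normSq (S *ᵥ (β - mu X v Q z))) / 2) *
        Real.exp (-(normSq z + v ⬝ᵥ (Q *ᵥ v) - normSq (S *ᵥ mu X v Q z)) / 2) := by
    rw [← Real.exp_add, ← Real.exp_add]
    congr 1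
    have := h.complete v β z
    linarith
  rw [e1, prod_nphi, h.qD_eq, prod_nphi]
  calc _ = (∏ i, ind (Y i) (z i)) * (Real.sqrt (2 * Real.pi))⁻¹ ^ n *
        (Real.exp (-(normSq (z - X *ᵥ β)) / 2) *
          Real.exp (-((β - v) ⬝ᵥ (Q *ᵥ (β - v))) / 2)) := by ring
    _ = _ := by
      rw [e2, ← mul_assoc S.det, ← hc]
      field_simp

lemma postUnnorm_nonneg (X : Matrix (Fin n) (Fin p) ℝ) (Y : Fin n → Bool) (v : Fin p → ℝ)
    (Q : Matrix (Fin p) (Fin p) ℝ) (β : Fin p → ℝ) : 0 ≤ postUnnorm X Y v Q β := by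
  unfold postUnnorm
  refine mul_nonneg (Finset.prod_nonneg fun i _ => ?_) (Real.exp_pos _).le
  split_ifs
  · exact (nPhi_pos _).le
  · exact (sub_pos.mpr (nPhi_lt_one _)).le

lemma continuous_postUnnorm (X : Matrix (Fin n) (Fin p) ℝ) (Y : Fin n → Bool) (v : Fin p → ℝ)
    (Q : Matrix (Fin p) (Fin p) ℝ) : Continuous (postUnnorm X Y v Q) := by
  unfold postUnnorm
  refine Continuous.mul (continuous_finsetProd _ fun i _ => ?_) ?_
  · have hc : Continuous fun β : Fin p → ℝ => nPhi (X i ⬝ᵥ β) :=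
      continuous_nPhi.comp (Continuous.dotProduct continuous_const continuous_id)
    cases Y i
    · simp only [Bool.false_eq_true, if_false]
      exact continuous_const.sub hc
    · simpa using hc
  · have h1 : Continuous fun β : Fin p → ℝ => β - v := continuous_id.sub continuous_const
    have h2 : Continuous fun β : Fin p → ℝ => (β - v) ⬝ᵥ (Q *ᵥ (β - v)) :=
      h1.dotProduct (Continuous.matrix_mulVec continuous_const h1)
    exact Real.continuous_exp.comp (h2.neg.div_const 2)

lemma Hyp.post (h : Hyp X Q S T) {Y : Fin n → Bool} {v Bhat : Fin p → ℝ}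
    (hm : IsPosteriorMode X Y v Q Bhat) (hproper : Integrable (postUnnorm X Y v Q))
    (hpos : 0 < ∫ β, postUnnorm X Y v Q β) (hlam : sSup (lamSet X Y S T Bhat) < 1) :
    Measurable (postDen X Y v Q) ∧ Integrable (postDen X Y v Q) ∧ (∀ x, 0 ≤ postDen X Y v Q x) ∧
    (∫ x, postDen X Y v Q x = 1) ∧
    (∀ (C : ℝ) (F : (Fin p → ℝ) → ℝ), BM C F →
      ∫ x, postDen X Y v Q x * op (tauD X Y) (op (qD X v Q) F) x = ∫ x, postDen X Y v Q x * F x) ∧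
    Integrable (fun x => postDen X Y v Q x * Ufun X Y v Q S Bhat x) ∧
    ∫ x, postDen X Y v Q x * Ufun X Y v Q S Bhat x ≤
      p * (1 + sSup (lamSet X Y S T Bhat)) / (1 - sSup (lamSet X Y S T Bhat)) := by
  have hlam0 := lamSet_nonneg X Y S T Bhat
  set lam := sSup (lamSet X Y S T Bhat) with hl
  set c := ∫ β, postUnnorm X Y v Q β with hc
  have πm : Measurable (postDen X Y v Q) := (continuous_postUnnorm X Y v Q).measurable.div_const _
  have πi : Integrable (postDen X Y v Q) := hproper.div_const _
  have π0 : ∀ x, 0 ≤ postDen X Y v Q x := fun x =>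
    div_nonneg (postUnnorm_nonneg X Y v Q x) hpos.le
  have π1 : ∫ x, postDen X Y v Q x = 1 := by
    unfold postDen
    rw [integral_div, div_self hpos.ne']
  have hτ := MDtau X Y
  have hq := h.MDq v
  obtain ⟨G, hG⟩ := h.joint Y v
  have hst : ∀ (C : ℝ) (F : (Fin p → ℝ) → ℝ), BM C F →
      ∫ x, postDen X Y v Q x * op (tauD X Y) (op (qD X v Q) F) x
        = ∫ x, postDen X Y v Q x * F x := by
    intro C F hF
    refine stationary hτ hq πi (G := fun z => G z / c) (fun β z => ?_) hF
    unfold postDen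
    rw [div_mul_eq_mul_div, hG, mul_div_assoc]
  set W : (Fin p → ℝ) → ℝ := fun β => normSq (S *ᵥ (β - Bhat)) with hW
  have hWm : Measurable W := (continuous_quad S Bhat).measurable
  have hW0 : ∀ x, 0 ≤ W x := fun x => normSq_nonneg' _
  set tr := trace (X * (Sg X Q)⁻¹ * Xᵀ) with htr
  have htr0 : 0 ≤ tr := h.trace_nn
  have htrp : tr ≤ p := h.trace_le
  have hN : ∀ N : ℕ, BM N (fun x => min (W x) N) := fun N =>
    ⟨hWm.min measurable_const, fun x => by
      rw [abs_of_nonneg (le_min (hW0 x) (Nat.cast_nonneg N))]; exact min_le_right _ _⟩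
  have hD := drift_integrable (W := W) hWm hW0 πi π0 (b := p + tr) (lam := lam) (by positivity)
    hlam π1 (P := fun F => op (tauD X Y) (op (qD X v Q) F))
    (fun N => op_bm hτ (op_bm hq (hN N))) (fun N x => ?_) (fun N => hst N _ (hN N))
  · obtain ⟨hD1, hD2⟩ := hD
    have hdom : Integrable fun x => tr * postDen X Y v Q x + lam * (postDen X Y v Q x * W x) :=
      (πi.const_mul tr).add (hD1.const_mul lam)
    have hle : ∀ x, postDen X Y v Q x * Ufun X Y v Q S Bhat x ≤
        tr * postDen X Y v Q x + lam * (postDen X Y v Q x * W x) := by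
      intro x
      refine (mul_le_mul_of_nonneg_left (h.Ule hm x) (π0 x)).trans (le_of_eq ?_)
      ring
    have hIntg : Integrable (fun x => postDen X Y v Q x * Ufun X Y v Q S Bhat x) := by
      refine hdom.mono' ?_ (Eventually.of_forall fun x => ?_)
      · exact πm.aestronglyMeasurable.mul (continuous_Ufun X Y v Q S Bhat).aestronglyMeasurable
      · rw [Real.norm_of_nonneg (mul_nonneg (π0 x) (h.U0 Y v Bhat x))]
        exact hle x
    refine ⟨πm, πi, π0, π1, hst, hIntg, (integral_mono hIntg hdom hle).trans ?_⟩
    rw [integral_add (πi.const_mul tr) (hD1.const_mul lam), integral_const_mul,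
      integral_const_mul, π1]
    have h1 : 0 < 1 - lam := by linarith
    rw [le_div_iff₀ h1] at hD2 ⊢
    nlinarith
  · have hq1 : ∀ z, op (qD X v Q) (fun x => min (W x) N) z ≤
        p + normSq (S *ᵥ (mu X v Q z - Bhat)) := by
      intro z
      have hqw := h.qW v Bhat z
      rw [← hqw.2]
      refine integral_mono ((hN N).int (hq.int z)) hqw.1 fun β => ?_
      exact mul_le_mul_of_nonneg_left (min_le_left _ _) (hq.nonneg z β)
    have hτV := h.tauV Y v Bhat x
    have h2 : op (tauD X Y) (op (qD X v Q) fun x => min (W x) N) x ≤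
        p + Ufun X Y v Q S Bhat x := by
      have hd : Integrable fun z => p * tauD X Y x z +
          tauD X Y x z * normSq (S *ᵥ (mu X v Q z - Bhat)) :=
        ((hτ.int x).const_mul _).add hτV.1
      have : op (tauD X Y) (op (qD X v Q) fun x => min (W x) N) x ≤
          ∫ z, (p * tauD X Y x z + tauD X Y x z * normSq (S *ᵥ (mu X v Q z - Bhat))) := by
        refine integral_mono ((op_bm hq (hN N)).int (hτ.int x)) hd fun z => ?_
        refine (mul_le_mul_of_nonneg_left (hq1 z) (hτ.nonneg x z)).trans (le_of_eq ?_)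
        ring
      refine this.trans ?_
      rw [integral_add ((hτ.int x).const_mul _) hτV.1, integral_const_mul, hτ.one, mul_one]
      linarith [hτV.2]
    have h3 := h.Ule hm x
    show op (tauD X Y) (op (qD X v Q) fun x => min (W x) N) x ≤ p + tr + lam * W x
    have h4 : Ufun X Y v Q S Bhat x ≤ tr + lam * W x := h3
    linarith

end post

/-- numeric choice of the exponent -/
lemma choose_s {a A g r : ℝ} (ha : 0 < a) (ha1 : a < 1) (hg : 0 < g) (hg1 : g < 1)
    (hA : 3 ≤ A) (ha3 : 1 / 3 ≤ a) :
    ∃ s : ℝ, 0 ≤ s ∧ s ≤ 1 / 2 ∧ a ^ (1 - s) * A ^ s = g ^ s ∧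
      g ^ s ≤ max (a ^ r) (g ^ (1 - r) * A ^ r) := by
  have hA0 : 0 < A := by linarith
  set x := -Real.log a with hx
  set y := Real.log A - Real.log g with hy
  have hx0 : 0 < x := neg_pos.mpr (Real.log_neg ha ha1)
  have hlg : Real.log g < 0 := Real.log_neg hg hg1
  have hxA : x ≤ Real.log A := by
    rw [hx, ← Real.log_inv]
    refine Real.log_le_log (by positivity) ?_
    refine le_trans ?_ hA
    rw [inv_le_comm₀ ha (by norm_num)]
    linarith
  have hxy : x ≤ y := by linarith
  have hpos : 0 < x + y := by linarith
  set s := x / (x + y) with hs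
  have hs0 : 0 ≤ s := by positivity
  have hs1 : s ≤ 1 / 2 := by
    rw [hs, div_le_iff₀ hpos]; linarith
  have hsx : s * (x + y) = x := div_mul_cancel₀ _ hpos.ne'
  have hlog : Real.log a * (1 - s) + Real.log A * s = Real.log g * s := by
    have : Real.log a = -x := by rw [hx]; ring
    have h2 : Real.log A = y + Real.log g := by rw [hy]; ring
    rw [this, h2]; linarith
  refine ⟨s, hs0, hs1, ?_, ?_⟩
  · rw [Real.rpow_def_of_pos ha, Real.rpow_def_of_pos hA0, Real.rpow_def_of_pos hg,
      ← Real.exp_add, hlog]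
  · rw [Real.rpow_def_of_pos ha, Real.rpow_def_of_pos hA0, Real.rpow_def_of_pos hg,
      Real.rpow_def_of_pos hg, ← Real.exp_add, le_max_iff, Real.exp_le_exp, Real.exp_le_exp]
    by_contra! hcon
    obtain ⟨h1, h2⟩ := hcon
    have h3 : (1 - s) * (Real.log a * r) + s * (Real.log g * (1 - r) + Real.log A * r)
        < Real.log g * s := by
      have i1 := mul_lt_mul_of_pos_left h1 (show 0 < 1 - s by linarith)
      have i2 := mul_le_mul_of_nonneg_left h2.le hs0
      nlinarith
    have h4 : (1 - s) * (Real.log a * r) + s * (Real.log g * (1 - r) + Real.log A * r)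
        = r * (Real.log a * (1 - s) + Real.log A * s) + s * (1 - r) * Real.log g := by ring
    rw [h4, hlog] at h3
    nlinarith

/-- computable total variation bound for Albert and Chib's chain based
on the drift function V₁.  Here `S` is Σ^{1/2} and `T` is Σ^{-1/2}.  The m-step
transition density k_AC^{(m)} (m ≥ 1) is `kIter (kAC X Y v Q) (m-1)`. -/
theorem tv_bound_V1
    (n p : ℕ) (hn : 1 ≤ n) (hp : 1 ≤ p)
    (X : Matrix (Fin n) (Fin p) ℝ) (Y : Fin n → Bool)
    (v : Fin p → ℝ) (Q : Matrix (Fin p) (Fin p) ℝ) (hQ : Q.PosSemidef)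
    (hSig : IsUnit (Xᵀ * X + Q).det)
    (hrank : X.rank = p)
    (hproper : Integrable (postUnnorm X Y v Q))
    (hpos : 0 < ∫ β, postUnnorm X Y v Q β)
    (Bhat : Fin p → ℝ) (hmode : IsPosteriorMode X Y v Q Bhat)
    (S : Matrix (Fin p) (Fin p) ℝ) (hS : S.PosSemidef) (hSS : S * S = Xᵀ * X + Q)
    (T : Matrix (Fin p) (Fin p) ℝ) (hT : T.PosSemidef) (hTT : T * T = (Xᵀ * X + Q)⁻¹)
    (lam : ℝ)
    (hlamdef : lam = sSup {r : ℝ | ∃ t ∈ Set.Ioo (0 : ℝ) 1, ∃ α : Fin p → ℝ, α ≠ 0 ∧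
      r = normSq ((T * Xᵀ * Dmat X Y (Bhat + t • α) * X).mulVec α) / normSq (S.mulVec α)})
    (hlam : lam < 1)
    (L : ℝ) (hL : L = p * (1 + lam))
    (d : ℝ) (hd : d > 2 * L / (1 - lam))
    (r : ℝ) (hr : r ∈ Set.Ioo (0 : ℝ) 1)
    (eps : ℝ) (heps : eps = (2 : ℝ) ^ (-(p : ℝ) / 2) * Real.exp (-d))
    (rhoHat : ℝ)
    (hrho : rhoHat = max ((1 - eps) ^ r)
      (((1 + 2 * L + lam * d) / (1 + d)) ^ (1 - r) * (1 + 2 * (lam * d + L)) ^ r))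
    (H : (Fin p → ℝ) → ℝ)
    (hH : ∀ β, H β = 2 + L / (1 - lam) + Matrix.trace (X * (Xᵀ * X + Q)⁻¹ * Xᵀ)
      + normSq (S.mulVec ((Xᵀ * X + Q)⁻¹.mulVec (Xᵀ.mulVec (phibar X Y β) + Q.mulVec v)
          - Bhat))) :
    ∀ (m : ℕ) (β : Fin p → ℝ),
      (∫ β' : Fin p → ℝ, |kIter (kAC X Y v Q) m β β' - postDen X Y v Q β'|)
        ≤ H β * rhoHat ^ m := by
  have h : Hyp X Q S T := ⟨hQ, hSig, hS, hSS, hT, hTT⟩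
  have hlam' : lam = sSup (lamSet X Y S T Bhat) := hlamdef
  have hlam0 : 0 ≤ lam := hlam' ▸ lamSet_nonneg X Y S T Bhat
  have hDM := h.DM hmode d
  rw [← hlam', ← hL, ← heps] at hDM
  obtain ⟨πm, πi, π0, π1, hst, πU, hE⟩ := h.post hmode hproper hpos (hlam' ▸ hlam)
  rw [← hlam', ← hL] at hE
  have hp1 : (1 : ℝ) ≤ p := by exact_mod_cast hp
  have hL1 : 1 ≤ L := by rw [hL]; nlinarith
  have h1l : 0 < 1 - lam := by linarith
  have hd' : 2 * L < d * (1 - lam) := (div_lt_iff₀ h1l).mp hd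
  have hd2 : 2 < d := by nlinarith
  have hexp : Real.exp (-d) ≤ 1 / 3 := by
    have h1 : (3 : ℝ) ≤ Real.exp d := by linarith [Real.add_one_le_exp d]
    rw [Real.exp_neg, one_div]
    exact inv_anti₀ (by norm_num) h1
  have h2p : (2 : ℝ) ^ (-(p : ℝ) / 2) ≤ 1 :=
    Real.rpow_le_one_of_one_le_of_nonpos (by norm_num) (by linarith)
  have h2p0 : 0 < (2 : ℝ) ^ (-(p : ℝ) / 2) := Real.rpow_pos_of_pos (by norm_num) _
  have heps0 : 0 < eps := by rw [heps]; exact mul_pos h2p0 (Real.exp_pos _)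
  have heps1 : eps ≤ 1 / 3 := by
    rw [heps]
    have := mul_le_mul_of_nonneg_right h2p (Real.exp_pos (-d)).le
    linarith
  have hld : 0 ≤ lam * d := mul_nonneg hlam0 (by linarith)
  have hg0 : 0 < (1 + 2 * L + lam * d) / (1 + d) := div_pos (by linarith) (by linarith)
  have hg1 : (1 + 2 * L + lam * d) / (1 + d) < 1 := by
    rw [div_lt_one (by linarith)]; linarith
  obtain ⟨s, hs0, hs1, hs, hle⟩ := choose_s (a := 1 - eps) (A := 1 + 2 * (lam * d + L)) (r := r)
    (by linarith) (by linarith) hg0 hg1 (by linarith) (by linarith)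
  rw [← hrho] at hle
  intro m β
  have hk : kAC X Y v Q = fun x y => ∫ z, tauD X Y x z * qD X v Q z y := by
    funext x y
    exact integral_congr_ae (Eventually.of_forall fun z => mul_comm _ _)
  have hfin := hDM.final (by linarith) hlam0 hlam (by linarith) (by linarith) hs0 hs1 rfl rfl hs
    πm πi π0 π1 (fun F hF => hst 1 F hF) πU hE hk m β
  refine hfin.trans ?_
  have hHβ : H β = 2 + Ufun X Y v Q S Bhat β + L / (1 - lam) := by
    rw [hH]; unfold Ufun mu Sg; ring
  rw [hHβ]
  have hU0 := h.U0 Y v Bhat β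
  have hL0 : 0 ≤ L / (1 - lam) := div_nonneg (by linarith) h1l.le
  refine mul_le_mul_of_nonneg_left (pow_le_pow_left₀ (Real.rpow_nonneg hg0.le _) hle m) ?_
  linarith
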